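/- arXiv:1304.5048 — 3 statements merged into one kernel-verified Lean document; each statement's English description precedes it below -/
import Mathlib

section
/- Let 𝐡 be a distribution in 𝔇'_q for some q>0. Then the following two properties are equivalent: (a) for every q'∈(0, q/e) there exists a distribution 𝐠 ∈ 𝔇'_{q'} such that ∂̄𝐠 = 𝐡; (b) ⟨𝐡, z^k⟩ = 0 for every k ∈ ℤ₊. -/
open MeasureTheory Filter Complex Metric

noncomputable section

/-- The Gaussian weight `ω(z) = π⁻¹ exp (-|z|²)`. -/
def omegaW (z : ℂ) : ℝ := Real.pi⁻¹ * Real.exp (-‖z‖ ^ 2)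

/-- Membership in the weighted space `Λ_{q,l}`: `C^l`-smooth functions whose
derivatives up to order `l` are `o(exp (q|z|²))` at infinity. -/
def MemLambda (q : ℝ) (l : ℕ) (ψ : ℂ → ℂ) : Prop :=
  ContDiff ℝ (l : ℕ∞) ψ ∧
    ∀ n : ℕ, n ≤ l →
      Tendsto (fun z : ℂ => ‖iteratedFDeriv ℝ n ψ z‖ * Real.exp (-q * ‖z‖ ^ 2))
        (cocompact ℂ) (nhds 0)

/-- The norm of `Λ_{q,l}`. -/
def lambdaNorm (q : ℝ) (l : ℕ) (ψ : ℂ → ℂ) : ℝ :=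
  sSup {r : ℝ | ∃ n ≤ l, ∃ z : ℂ, r = ‖iteratedFDeriv ℝ n ψ z‖ * Real.exp (-q * ‖z‖ ^ 2)}

/-- Distributions on `ℂ`, encoded by their pairing against test functions
(with respect to Lebesgue measure). -/
abbrev Dst : Type := (ℂ → ℂ) → ℂ

/-- Membership in the dual space `Λ'_{q,l}`. -/
def MemLambdaDual (q : ℝ) (l : ℕ) (T : Dst) : Prop :=
  (∀ ψ φ, MemLambda q l ψ → MemLambda q l φ → T (ψ + φ) = T ψ + T φ) ∧
  (∀ (c : ℂ) (ψ), MemLambda q l ψ → T (c • ψ) = c * T ψ) ∧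
  (∃ C : ℝ, ∀ ψ, MemLambda q l ψ → ‖T ψ‖ ≤ C * lambdaNorm q l ψ)

/-- The dual norm on `Λ'_{q,l}`. -/
def lambdaDualNorm (q : ℝ) (l : ℕ) (T : Dst) : ℝ :=
  sInf {C : ℝ | 0 ≤ C ∧ ∀ ψ, MemLambda q l ψ → ‖T ψ‖ ≤ C * lambdaNorm q l ψ}

/-- `∂̄ = (∂/∂x + i ∂/∂y)/2` of a function. -/
def dbarFun (ψ : ℂ → ℂ) : ℂ → ℂ := fun z =>
  (fderiv ℝ ψ z 1 + Complex.I * fderiv ℝ ψ z Complex.I) / 2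

/-- Membership in `𝔇_q`: smooth functions all of whose derivatives are
`o(exp (q|z|²))`. -/
def MemDq (q : ℝ) (ψ : ℂ → ℂ) : Prop :=
  ContDiff ℝ (⊤ : ℕ∞) ψ ∧
    ∀ n : ℕ,
      Tendsto (fun z : ℂ => ‖iteratedFDeriv ℝ n ψ z‖ * Real.exp (-q * ‖z‖ ^ 2))
        (cocompact ℂ) (nhds 0)

/-- Membership in the dual space `𝔇'_q`; every such distribution has finite
order, i.e. is bounded by some `Λ_{q,l}`-norm. -/
def MemDqDual (q : ℝ) (T : Dst) : Prop :=
  (∀ ψ φ, MemDq q ψ → MemDq q φ → T (ψ + φ) = T ψ + T φ) ∧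
  (∀ (c : ℂ) (ψ), MemDq q ψ → T (c • ψ) = c * T ψ) ∧
  (∃ (l : ℕ) (C : ℝ), ∀ ψ, MemDq q ψ → ‖T ψ‖ ≤ C * lambdaNorm q l ψ)

/-- Membership in the Fock space `𝓑`: entire and square integrable against `ω dλ`. -/
def MemFock (u : ℂ → ℂ) : Prop :=
  Differentiable ℂ u ∧ Integrable (fun z : ℂ => ‖u z‖ ^ 2 * omegaW z)

/-- The Fock norm. -/
def fockNorm (u : ℂ → ℂ) : ℝ := Real.sqrt (∫ z : ℂ, ‖u z‖ ^ 2 * omegaW z)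

/-- The Fock (weighted `L²`) inner product `(u,v) = ∫ u v̄ ω dλ`. -/
def fockInner (u v : ℂ → ℂ) : ℂ := ∫ z : ℂ, u z * (starRingEnd ℂ) (v z) * (omegaW z : ℂ)

/-- The reproducing kernel `κ_z(w) = exp (w z̄)`. -/
def repKer (z : ℂ) : ℂ → ℂ := fun w => Complex.exp (w * (starRingEnd ℂ) z)

/-- The Toeplitz sesquilinear form `𝐭_F(u,v) = ⟨ωF, u v̄⟩`, expressed through the
distribution `T = 𝐅 = ωF`. -/
def toeplitzForm (T : Dst) (u v : ℂ → ℂ) : ℂ := T fun z => u z * (starRingEnd ℂ) (v z)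

/-- An infinite matrix has rank at most `N` iff every finite submatrix does. -/
def InfRankLE (A : ℕ → ℕ → ℂ) (N : ℕ) : Prop :=
  ∀ (m : ℕ) (r c : Fin m → ℕ), (Matrix.of fun i j : Fin m => A (r i) (c j)).rank ≤ N

/-- The matrix `𝔓(F)` with entries `𝐭_F(z^k, z^{k'})`. -/
def matP (T : Dst) : ℕ → ℕ → ℂ :=
  fun k k' => toeplitzForm T (fun z => z ^ k) (fun z => z ^ k')

/-- The matrix `𝔎(F)` attached to a sequence of points, with entries
`𝐭_F(κ_{z_k}, κ_{z_{k'}})`. -/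
def matK (T : Dst) (zs : ℕ → ℂ) : ℕ → ℕ → ℂ :=
  fun k k' => toeplitzForm T (repKer (zs k)) (repKer (zs k'))

/-- The scaling `S_t ψ (z) = t ψ(tz)`. -/
def scaleS (t : ℝ) (ψ : ℂ → ℂ) : ℂ → ℂ := fun z => (t : ℂ) * ψ ((t : ℂ) * z)

/-- The scaling `W_t` on distributions, `⟨W_t 𝐅, ψ⟩ = ⟨𝐅, S_{t⁻¹} ψ⟩`. -/
def scaleW (t : ℝ) (T : Dst) : Dst := fun ψ => T (scaleS t⁻¹ ψ)

/-! ### Elementary facts about `MemDq` and `lambdaNorm` -/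

lemma tendsto_exp_neg_mul_sq_cocompact {b : ℝ} (hb : 0 < b) :
    Tendsto (fun z : ℂ => Real.exp (-b * ‖z‖ ^ 2)) (cocompact ℂ) (nhds 0) := by
  refine Real.tendsto_exp_atBot.comp ?_
  have h1 : Tendsto (fun z : ℂ => ‖z‖ ^ 2) (cocompact ℂ) atTop :=
    (tendsto_pow_atTop two_ne_zero).comp (tendsto_norm_cocompact_atTop)
  exact h1.const_mul_atTop_of_neg (neg_lt_zero.2 hb)

lemma MemDq.bddAbove {q : ℝ} {ψ : ℂ → ℂ} (hψ : MemDq q ψ) (l : ℕ) :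
    BddAbove {r : ℝ | ∃ n ≤ l, ∃ z : ℂ,
      r = ‖iteratedFDeriv ℝ n ψ z‖ * Real.exp (-q * ‖z‖ ^ 2)} := by
  have key : ∀ n : ℕ, ∃ B : ℝ, 0 ≤ B ∧
      ∀ z, ‖iteratedFDeriv ℝ n ψ z‖ * Real.exp (-q * ‖z‖ ^ 2) ≤ B := by
    intro n
    have hc : Continuous fun z : ℂ => ‖iteratedFDeriv ℝ n ψ z‖ * Real.exp (-q * ‖z‖ ^ 2) := by
      have := hψ.1.continuous_iteratedFDeriv (m := n) (by exact_mod_cast le_top)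
      fun_prop
    obtain ⟨B, hB⟩ :=
      (ZeroAtInftyContinuousMap.isBounded_range ⟨⟨_, hc⟩, hψ.2 n⟩).bddAbove
    exact ⟨max B 0, le_max_right _ _, fun z => (hB ⟨z, rfl⟩).trans (le_max_left _ _)⟩
  choose B hB0 hB using key
  refine ⟨∑ n ∈ Finset.range (l + 1), B n, ?_⟩
  rintro r ⟨n, hn, z, rfl⟩
  exact (hB n z).trans (Finset.single_le_sum (f := B) (fun i _ => hB0 i)
    (Finset.mem_range.2 (by omega)))

lemma lambdaNorm_nonneg (q : ℝ) (l : ℕ) (ψ : ℂ → ℂ) : 0 ≤ lambdaNorm q l ψ := by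
  refine Real.sSup_nonneg ?_
  rintro r ⟨n, -, z, rfl⟩
  positivity

lemma MemDq.norm_iteratedFDeriv_le {q : ℝ} {ψ : ℂ → ℂ} (hψ : MemDq q ψ) {n l : ℕ} (hn : n ≤ l)
    (z : ℂ) : ‖iteratedFDeriv ℝ n ψ z‖ ≤ lambdaNorm q l ψ * Real.exp (q * ‖z‖ ^ 2) := by
  have h1 : ‖iteratedFDeriv ℝ n ψ z‖ * Real.exp (-q * ‖z‖ ^ 2) ≤ lambdaNorm q l ψ :=
    le_csSup (hψ.bddAbove l) ⟨n, hn, z, rfl⟩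
  calc ‖iteratedFDeriv ℝ n ψ z‖
      = ‖iteratedFDeriv ℝ n ψ z‖ * Real.exp (-q * ‖z‖ ^ 2) * Real.exp (q * ‖z‖ ^ 2) := by
        rw [mul_assoc, ← Real.exp_add]; simp
    _ ≤ _ := by gcongr

lemma lambdaNorm_le {q B : ℝ} {l : ℕ} {ψ : ℂ → ℂ} (hB : 0 ≤ B)
    (h : ∀ n ≤ l, ∀ z, ‖iteratedFDeriv ℝ n ψ z‖ ≤ B * Real.exp (q * ‖z‖ ^ 2)) :
    lambdaNorm q l ψ ≤ B := by
  refine Real.sSup_le ?_ hB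
  rintro r ⟨n, hn, z, rfl⟩
  calc ‖iteratedFDeriv ℝ n ψ z‖ * Real.exp (-q * ‖z‖ ^ 2)
      ≤ B * Real.exp (q * ‖z‖ ^ 2) * Real.exp (-q * ‖z‖ ^ 2) := by gcongr; exact h n hn z
    _ = B := by rw [mul_assoc, ← Real.exp_add]; simp

lemma MemDq.of_le {a q : ℝ} (haq : a < q) {ψ : ℂ → ℂ} (hc : ContDiff ℝ (⊤ : ℕ∞) ψ)
    (h : ∀ n : ℕ, ∃ K : ℝ, ∀ z, ‖iteratedFDeriv ℝ n ψ z‖ ≤ K * Real.exp (a * ‖z‖ ^ 2)) :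
    MemDq q ψ := by
  refine ⟨hc, fun n => ?_⟩
  obtain ⟨K, hK⟩ := h n
  have h1 := (tendsto_exp_neg_mul_sq_cocompact (sub_pos.2 haq)).const_mul K
  rw [mul_zero] at h1
  refine squeeze_zero (fun z => by positivity) (fun z => ?_) h1
  calc ‖iteratedFDeriv ℝ n ψ z‖ * Real.exp (-q * ‖z‖ ^ 2)
      ≤ K * Real.exp (a * ‖z‖ ^ 2) * Real.exp (-q * ‖z‖ ^ 2) := by gcongr; exact hK z
    _ = _ := by rw [mul_assoc, ← Real.exp_add]; ring_nf

lemma MemDq.mono {a q : ℝ} (haq : a < q) {ψ : ℂ → ℂ} (hψ : MemDq a ψ) : MemDq q ψ :=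
  .of_le haq hψ.1 fun n => ⟨lambdaNorm a n ψ, hψ.norm_iteratedFDeriv_le le_rfl⟩

lemma MemDq.add {q : ℝ} {ψ φ : ℂ → ℂ} (hψ : MemDq q ψ) (hφ : MemDq q φ) : MemDq q (ψ + φ) := by
  refine ⟨hψ.1.add hφ.1, fun n => ?_⟩
  have h1 := (hψ.2 n).add (hφ.2 n)
  rw [add_zero] at h1
  refine squeeze_zero (fun z => by positivity) (fun z => ?_) h1
  rw [iteratedFDeriv_add_apply (hψ.1.contDiffAt.of_le (by exact_mod_cast le_top))
    (hφ.1.contDiffAt.of_le (by exact_mod_cast le_top)), ← add_mul]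
  gcongr
  exact norm_add_le _ _

lemma MemDq.const_smul {q : ℝ} {ψ : ℂ → ℂ} (hψ : MemDq q ψ) (c : ℂ) : MemDq q (c • ψ) := by
  refine ⟨contDiff_const.smul hψ.1, fun n => ?_⟩
  have h1 := (hψ.2 n).const_mul ‖c‖
  rw [mul_zero] at h1
  refine squeeze_zero (fun z => by positivity) (fun z => ?_) h1
  rw [iteratedFDeriv_const_smul_apply (hψ.1.contDiffAt.of_le (by exact_mod_cast le_top)),
    norm_smul, mul_assoc]

lemma MemDq.zero (q : ℝ) : MemDq q 0 :=
  ⟨contDiff_const, fun n => by simp⟩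

lemma MemDq.lambdaNorm_add_le {q : ℝ} {ψ φ : ℂ → ℂ} (hψ : MemDq q ψ) (hφ : MemDq q φ) (l : ℕ) :
    lambdaNorm q l (ψ + φ) ≤ lambdaNorm q l ψ + lambdaNorm q l φ := by
  refine lambdaNorm_le (add_nonneg (lambdaNorm_nonneg _ _ _) (lambdaNorm_nonneg _ _ _))
    fun n hn z => ?_
  rw [iteratedFDeriv_add_apply (hψ.1.contDiffAt.of_le (by exact_mod_cast le_top))
    (hφ.1.contDiffAt.of_le (by exact_mod_cast le_top)), add_mul]
  exact (norm_add_le _ _).trans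
    (add_le_add (hψ.norm_iteratedFDeriv_le hn z) (hφ.norm_iteratedFDeriv_le hn z))

lemma MemDq.lambdaNorm_smul_le {q : ℝ} {ψ : ℂ → ℂ} (hψ : MemDq q ψ) (c : ℂ) (l : ℕ) :
    lambdaNorm q l (c • ψ) ≤ ‖c‖ * lambdaNorm q l ψ := by
  refine lambdaNorm_le (mul_nonneg (norm_nonneg _) (lambdaNorm_nonneg _ _ _)) fun n hn z => ?_
  rw [iteratedFDeriv_const_smul_apply (hψ.1.contDiffAt.of_le (by exact_mod_cast le_top)),
    norm_smul, mul_assoc]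
  gcongr
  exact hψ.norm_iteratedFDeriv_le hn z

/-- The real-linear functional `L ↦ (L 1 + i L i) / 2` on `ℂ →L[ℝ] ℂ`. -/
def dbarCLM : (ℂ →L[ℝ] ℂ) →L[ℝ] ℂ :=
  (2⁻¹ : ℂ) • (ContinuousLinearMap.apply ℝ ℂ (1 : ℂ) +
    Complex.I • ContinuousLinearMap.apply ℝ ℂ Complex.I)

lemma dbarCLM_apply (L : ℂ →L[ℝ] ℂ) : dbarCLM L = (L 1 + Complex.I * L Complex.I) / 2 := by
  simp [dbarCLM]; ring

lemma dbarFun_eq_comp (ψ : ℂ → ℂ) : dbarFun ψ = dbarCLM ∘ fderiv ℝ ψ := by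
  ext z
  simp [dbarFun, dbarCLM_apply]

lemma MemDq.dbarFun {q : ℝ} {ψ : ℂ → ℂ} (hψ : MemDq q ψ) : MemDq q (dbarFun ψ) := by
  have h0 : ContDiff ℝ (⊤ : ℕ∞) (fderiv ℝ ψ) := hψ.1.fderiv_right (by simp)
  rw [dbarFun_eq_comp]
  refine ⟨dbarCLM.contDiff.comp h0, fun n => ?_⟩
  have h1 := (hψ.2 (n + 1)).const_mul ‖dbarCLM‖
  rw [mul_zero] at h1
  refine squeeze_zero (fun z => by positivity) (fun z => ?_) h1
  rw [← norm_iteratedFDeriv_fderiv, ← mul_assoc]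
  gcongr
  exact dbarCLM.norm_iteratedFDeriv_comp_left h0.contDiffAt (by exact_mod_cast le_top)

lemma dbarFun_add {ψ φ : ℂ → ℂ} (hψ : Differentiable ℝ ψ) (hφ : Differentiable ℝ φ) :
    dbarFun (ψ + φ) = dbarFun ψ + dbarFun φ := by
  ext z
  simp only [dbarFun_eq_comp, Function.comp_apply, Pi.add_apply, ← map_add]
  rw [fderiv_add (hψ z) (hφ z)]

lemma dbarFun_const_smul {ψ : ℂ → ℂ} (hψ : Differentiable ℝ ψ) (c : ℂ) :
    dbarFun (c • ψ) = c • dbarFun ψ := by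
  ext z
  simp only [dbarFun, Pi.smul_apply]
  rw [fderiv_const_smul (hψ z)]
  simp
  ring

lemma MemDq.differentiable {q : ℝ} {ψ : ℂ → ℂ} (hψ : MemDq q ψ) : Differentiable ℝ ψ :=
  hψ.1.differentiable (by simp)

/-! ### Entire functions of Gaussian growth -/

lemma norm_iteratedFDeriv_real_le_norm_iteratedDeriv {v : ℂ → ℂ} (hv : Differentiable ℂ v)
    (n : ℕ) (z : ℂ) : ‖iteratedFDeriv ℝ n v z‖ ≤ ‖iteratedDeriv n v z‖ := by
  induction n generalizing v with
  | zero => simp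
  | succ n ih =>
    have hd : Differentiable ℂ (deriv v) := hv.contDiff.differentiable_deriv_two
    have hfd : fderiv ℝ v = ContinuousLinearMap.mul ℝ ℂ ∘ deriv v := by
      ext1 w
      rw [(hv w).fderiv_restrictScalars ℝ]
      ext1 y
      simp [mul_comm]
    rw [← norm_iteratedFDeriv_fderiv, iteratedDeriv_succ', hfd]
    refine ((ContinuousLinearMap.mul ℝ ℂ).norm_iteratedFDeriv_comp_left
      ((hd.contDiff (n := (⊤ : ℕ∞))).restrict_scalars ℝ).contDiffAt
      (by exact_mod_cast le_top)).trans ?_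
    calc _ ≤ 1 * ‖iteratedFDeriv ℝ n (deriv v) z‖ := by
          gcongr; exact ContinuousLinearMap.opNorm_mul_le ℝ ℂ
      _ ≤ _ := by rw [one_mul]; exact ih hd

lemma mul_add_one_sq_le {b q : ℝ} (hbq : b < q) (r : ℝ) :
    b * (r + 1) ^ 2 ≤ (b + b ^ 2 / (q - b)) + q * r ^ 2 := by
  have h : 0 < q - b := sub_pos.2 hbq
  have : (b + b ^ 2 / (q - b)) + q * r ^ 2 - b * (r + 1) ^ 2
      = ((q - b) * r - b) ^ 2 / (q - b) := by
    field_simp; ring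
  have h2 : 0 ≤ ((q - b) * r - b) ^ 2 / (q - b) := by positivity
  linarith

lemma norm_iteratedFDeriv_le_of_entire {b q A : ℝ} (hb : 0 ≤ b) (hbq : b < q) (hA : 0 ≤ A)
    {v : ℂ → ℂ} (hv : Differentiable ℂ v) (hvA : ∀ z, ‖v z‖ ≤ A * Real.exp (b * ‖z‖ ^ 2))
    (n : ℕ) (z : ℂ) :
    ‖iteratedFDeriv ℝ n v z‖ ≤
      n.factorial * A * Real.exp (b + b ^ 2 / (q - b)) * Real.exp (q * ‖z‖ ^ 2) := by
  refine (norm_iteratedFDeriv_real_le_norm_iteratedDeriv hv n z).trans ?_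
  have h1 : ∀ w ∈ sphere z 1,
      ‖v w‖ ≤ A * (Real.exp (b + b ^ 2 / (q - b)) * Real.exp (q * ‖z‖ ^ 2)) := by
    intro w hw
    refine (hvA w).trans ?_
    rw [← Real.exp_add]
    gcongr
    refine le_trans ?_ (mul_add_one_sq_le hbq ‖z‖)
    have hwn : ‖w‖ ≤ ‖z‖ + 1 := by
      have h2 : ‖w - z‖ = 1 := by simpa using hw
      have h3 := norm_add_le z (w - z)
      rwa [add_sub_cancel, h2] at h3
    gcongr
  have h2 := Complex.norm_iteratedDeriv_le_of_forall_mem_sphere_norm_le n one_pos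
    hv.diffContOnCl h1
  refine h2.trans (le_of_eq ?_)
  simp only [one_pow, div_one]; ring

lemma MemDq.of_entire {b q A : ℝ} (hb : 0 ≤ b) (hbq : b < q) {v : ℂ → ℂ}
    (hv : Differentiable ℂ v) (hvA : ∀ z, ‖v z‖ ≤ A * Real.exp (b * ‖z‖ ^ 2)) : MemDq q v := by
  have hA : 0 ≤ A := by simpa using (norm_nonneg _).trans (hvA 0)
  have h1 : b < (b + q) / 2 := by linarith
  exact .of_le (a := (b + q) / 2) (by linarith)
    ((hv.contDiff (n := (⊤ : ℕ∞))).restrict_scalars ℝ) fun n =>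
      ⟨_, norm_iteratedFDeriv_le_of_entire hb h1 hA hv hvA n⟩

lemma lambdaNorm_le_of_entire {b q A : ℝ} (hb : 0 ≤ b) (hbq : b < q) {v : ℂ → ℂ}
    (hv : Differentiable ℂ v) (hvA : ∀ z, ‖v z‖ ≤ A * Real.exp (b * ‖z‖ ^ 2)) (l : ℕ) :
    lambdaNorm q l v ≤ l.factorial * A * Real.exp (b + b ^ 2 / (q - b)) := by
  have hA : 0 ≤ A := by simpa using (norm_nonneg _).trans (hvA 0)
  refine lambdaNorm_le (by positivity) fun n hn z => ?_
  refine (norm_iteratedFDeriv_le_of_entire hb hbq hA hv hvA n z).trans ?_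
  gcongr

lemma exists_pow_le_mul_exp_sq {b : ℝ} (hb : 0 < b) (k : ℕ) :
    ∃ A : ℝ, ∀ r : ℝ, 0 ≤ r → r ^ k ≤ A * Real.exp (b * r ^ 2) := by
  refine ⟨1 + k.factorial / b ^ k, fun r hr => ?_⟩
  have h1 : (b * r ^ 2) ^ k / k.factorial ≤ Real.exp (b * r ^ 2) :=
    Real.pow_div_factorial_le_exp _ (by positivity) k
  have h2 : 1 ≤ Real.exp (b * r ^ 2) := Real.one_le_exp (by positivity)
  have h3 : (r ^ k) ^ 2 ≤ k.factorial / b ^ k * Real.exp (b * r ^ 2) := by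
    rw [div_le_iff₀ (by positivity), mul_pow] at h1
    rw [div_mul_eq_mul_div, le_div_iff₀ (by positivity)]
    calc (r ^ k) ^ 2 * b ^ k = b ^ k * (r ^ 2) ^ k := by ring
      _ ≤ _ := by rw [mul_comm (k.factorial : ℝ)]; exact h1
  have h4 : r ^ k ≤ 1 + (r ^ k) ^ 2 := by nlinarith [sq_nonneg (r ^ k - 1)]
  linarith

lemma MemDq.pow {q : ℝ} (hq : 0 < q) (k : ℕ) : MemDq q fun z => z ^ k := by
  obtain ⟨A, hA⟩ := exists_pow_le_mul_exp_sq (half_pos hq) k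
  refine .of_entire (b := q / 2) (A := A) (by positivity) (by linarith) (by fun_prop) fun z => ?_
  rw [norm_pow]
  exact hA _ (norm_nonneg z)

lemma MemDqDual.map_zero {q : ℝ} {T : Dst} (hT : MemDqDual q T) : T 0 = 0 := by
  simpa using hT.2.1 0 0 (.zero q)

lemma MemDqDual.exists_bound {q : ℝ} {T : Dst} (hT : MemDqDual q T) :
    ∃ (l : ℕ) (C : ℝ), 0 ≤ C ∧ ∀ ψ, MemDq q ψ → ‖T ψ‖ ≤ C * lambdaNorm q l ψ := by
  obtain ⟨l, C, hC⟩ := hT.2.2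
  refine ⟨l, |C|, abs_nonneg C, fun ψ hψ => (hC ψ hψ).trans ?_⟩
  have := lambdaNorm_nonneg q l ψ
  gcongr
  exact le_abs_self C

lemma MemDqDual.map_polynomial_eq_zero {q : ℝ} (hq : 0 < q) {T : Dst} (hT : MemDqDual q T)
    (h0 : ∀ k : ℕ, T (fun z => z ^ k) = 0) (a : ℕ → ℂ) (N : ℕ) :
    MemDq q (fun z => ∑ k ∈ Finset.range N, a k * z ^ k) ∧
      T (fun z => ∑ k ∈ Finset.range N, a k * z ^ k) = 0 := by
  induction N with
  | zero => simpa using ⟨MemDq.zero q, hT.map_zero⟩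
  | succ N ih =>
    have h1 : (fun z : ℂ => ∑ k ∈ Finset.range (N + 1), a k * z ^ k)
        = (fun z => ∑ k ∈ Finset.range N, a k * z ^ k) + a N • fun z => z ^ N := by
      ext z
      simp [Finset.sum_range_succ]
    have h2 := (MemDq.pow hq N).const_smul (a N)
    rw [h1]
    exact ⟨ih.1.add h2, by rw [hT.1 _ _ ih.1 h2, ih.2, hT.2.1 _ _ (.pow hq N), h0]; simp⟩

lemma norm_taylorCoeff_mul_pow_le {b A : ℝ} {u : ℂ → ℂ} (hu : Differentiable ℂ u)
    (huA : ∀ z, ‖u z‖ ≤ A * Real.exp (b * ‖z‖ ^ 2)) (k : ℕ) {R : ℝ} (hR : 0 ≤ R) :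
    ‖(k.factorial : ℂ)⁻¹ * iteratedDeriv k u 0‖ * R ^ k ≤ A * Real.exp (b * R ^ 2) := by
  have hA : 0 ≤ A := by simpa using (norm_nonneg _).trans (huA 0)
  rcases hR.eq_or_lt with rfl | hR
  · rcases k with _ | k
    · simpa using huA 0
    · simpa using hA
  · have h1 := Complex.norm_iteratedDeriv_le_of_forall_mem_sphere_norm_le k hR
      (hu.diffContOnCl (s := ball 0 R)) (C := A * Real.exp (b * R ^ 2)) fun z hz => by
        have h2 : ‖z‖ = R := by simpa using hz
        simpa [h2] using huA z
    rw [norm_mul, norm_inv, Complex.norm_natCast]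
    have hk : (0 : ℝ) < k.factorial := by positivity
    calc (k.factorial : ℝ)⁻¹ * ‖iteratedDeriv k u 0‖ * R ^ k
        ≤ (k.factorial : ℝ)⁻¹ * (k.factorial * (A * Real.exp (b * R ^ 2)) / R ^ k) * R ^ k := by
          gcongr
      _ = _ := by field_simp

/-- The Taylor remainders of an entire function of Gaussian growth of type `b` decrease
geometrically in the weighted sup-norm with any larger type. -/
lemma exists_taylor_remainder_bound {b c A : ℝ} (hb : 0 < b) (hbc : b < c) {u : ℂ → ℂ}
    (hu : Differentiable ℂ u) (huA : ∀ z, ‖u z‖ ≤ A * Real.exp (b * ‖z‖ ^ 2)) :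
    ∃ (a : ℕ → ℂ) (B s : ℝ), 0 ≤ s ∧ s < 1 ∧ ∀ N z,
      ‖u z - ∑ k ∈ Finset.range N, a k * z ^ k‖ ≤ B * s ^ N * Real.exp (c * ‖z‖ ^ 2) := by
  have hA : 0 ≤ A := by simpa using (norm_nonneg _).trans (huA 0)
  set ρ : ℝ := √(c / b) with hρ
  have hρ1 : 1 < ρ := by
    rw [hρ, Real.lt_sqrt zero_le_one, one_pow, one_lt_div hb]; exact hbc
  have hρ0 : 0 < ρ := by linarith
  have hs1 : ρ⁻¹ < 1 := inv_lt_one_of_one_lt₀ hρ1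
  have hρb : b * ρ ^ 2 = c := by
    rw [hρ, Real.sq_sqrt (div_pos (hb.trans hbc) hb).le]; field_simp
  refine ⟨fun k => (k.factorial : ℂ)⁻¹ * iteratedDeriv k u 0, A * (1 - ρ⁻¹)⁻¹, ρ⁻¹,
    by positivity, hs1, fun N z => ?_⟩
  have hterm : ∀ k, ‖(k.factorial : ℂ)⁻¹ * iteratedDeriv k u 0 * z ^ k‖
      ≤ A * Real.exp (c * ‖z‖ ^ 2) * ρ⁻¹ ^ k := by
    intro k
    have h1 := norm_taylorCoeff_mul_pow_le hu huA k (R := ρ * ‖z‖) (by positivity)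
    rw [mul_pow, mul_pow, ← mul_assoc b, hρb] at h1
    rw [norm_mul, norm_pow, inv_pow, ← div_eq_mul_inv, le_div_iff₀ (by positivity)]
    calc _ = _ := by ring
      _ ≤ _ := h1
  have hsum : HasSum (fun k : ℕ => (k.factorial : ℂ)⁻¹ * iteratedDeriv k u 0 * z ^ k) (u z) := by
    refine (Complex.hasSum_taylorSeries_of_entire hu 0 z).congr_fun fun k => ?_
    rw [sub_zero, smul_eq_mul, smul_eq_mul]; ring
  have hshift := (hasSum_nat_add_iff' N).2 hsum
  have hgeo := ((hasSum_geometric_of_lt_one (by positivity) hs1).mul_left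
    (A * Real.exp (c * ‖z‖ ^ 2) * ρ⁻¹ ^ N))
  have := hshift.norm_le_of_bounded hgeo fun k => (hterm (k + N)).trans_eq (by ring)
  refine this.trans_eq (by ring)

lemma MemDqDual.map_entire_eq_zero {b q A : ℝ} (hb : 0 < b) (hbq : b < q) {T : Dst}
    (hT : MemDqDual q T) (h0 : ∀ k : ℕ, T (fun z => z ^ k) = 0) {u : ℂ → ℂ}
    (hu : Differentiable ℂ u) (huA : ∀ z, ‖u z‖ ≤ A * Real.exp (b * ‖z‖ ^ 2)) : T u = 0 := by
  have hbc : b < (b + q) / 2 := by linarith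
  have hcq : (b + q) / 2 < q := by linarith
  have hc0 : 0 ≤ (b + q) / 2 := by linarith
  obtain ⟨a, B, s, hs0, hs1, hB⟩ := exists_taylor_remainder_bound hb hbc hu huA
  obtain ⟨l, C, hC0, hC⟩ := hT.exists_bound
  set c := (b + q) / 2
  set K := Real.exp (c + c ^ 2 / (q - c))
  have hbound : ∀ N : ℕ, ‖T u‖ ≤ C * (l.factorial * B * K) * s ^ N := by
    intro N
    set S : ℂ → ℂ := fun z => ∑ k ∈ Finset.range N, a k * z ^ k
    obtain ⟨hS, hS0⟩ := hT.map_polynomial_eq_zero (hb.trans hbq) h0 a N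
    have hv : Differentiable ℂ fun z => u z - S z := by
      simp only [S]; fun_prop
    have hvm : MemDq q fun z => u z - S z := .of_entire hc0 hcq hv (hB N)
    have hsplit : u = (fun z => u z - S z) + S := by ext; simp
    rw [hsplit, hT.1 _ _ hvm hS, hS0, add_zero]
    refine (hC _ hvm).trans ?_
    calc _ ≤ C * (l.factorial * (B * s ^ N) * K) := by
          gcongr; exact lambdaNorm_le_of_entire hc0 hcq hv (hB N) l
      _ = _ := by ring
  have hlim := (tendsto_pow_atTop_nhds_zero_of_lt_one hs0 hs1).const_mul
    (C * (l.factorial * B * K))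
  rw [mul_zero] at hlim
  exact norm_le_zero_iff.1 (ge_of_tendsto' hlim hbound)

/-! ### The Cauchy–Pompeiu formula on the whole plane -/

lemma dbarFun_div_exp (Φ : ℂ → ℂ) (t : ℂ) {r : ℝ} (hr : r ≠ 0) (θ : ℝ) :
    r • (dbarFun Φ t / (r * Complex.exp (θ * Complex.I))) =
      2⁻¹ * (fderiv ℝ Φ t (Complex.exp (θ * Complex.I)) +
        Complex.I * fderiv ℝ Φ t (Complex.I * Complex.exp (θ * Complex.I))) := by
  set L := fderiv ℝ Φ t with hL
  have he : Complex.exp (θ * Complex.I) = Real.cos θ • (1 : ℂ) + Real.sin θ • Complex.I := by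
    rw [Complex.exp_mul_I]; simp
  have hIe : Complex.I * Complex.exp (θ * Complex.I)
      = Real.cos θ • Complex.I - Real.sin θ • (1 : ℂ) := by
    rw [he]; simp; ring_nf; simp; ring
  have hinv : (Complex.exp (θ * Complex.I))⁻¹ = Real.cos θ - Real.sin θ * Complex.I := by
    rw [← Complex.exp_neg, ← neg_mul, ← Complex.ofReal_neg, Complex.exp_mul_I]; simp
    ring
  have hr' : (r : ℂ) ≠ 0 := by exact_mod_cast hr
  have h1 : r • (dbarFun Φ t / (r * Complex.exp (θ * Complex.I)))
      = dbarFun Φ t * (Complex.exp (θ * Complex.I))⁻¹ := by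
    rw [Complex.real_smul]; field_simp
  rw [h1, hinv, hIe, he, map_add, map_sub, map_smul, map_smul, map_smul, map_smul, dbarFun, ← hL]
  simp only [Complex.real_smul]
  linear_combination -(2⁻¹ * (Real.sin θ : ℂ) * L Complex.I) * Complex.I_sq

lemma integral_fderiv_ray {Φ : ℂ → ℂ} (hΦ : ContDiff ℝ 1 Φ)
    (h0 : Tendsto Φ (cocompact ℂ) (nhds 0)) {B : ℝ → ℝ} (hB : IntegrableOn B (Set.Ioi 0))
    (hΦB : ∀ t, ‖fderiv ℝ Φ t‖ ≤ B ‖t‖) (θ : ℝ) :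
    ∫ r in Set.Ioi (0 : ℝ), fderiv ℝ Φ (r * Complex.exp (θ * Complex.I))
      (Complex.exp (θ * Complex.I)) = -Φ 0 := by
  set e := Complex.exp (θ * Complex.I) with he
  have hen : ‖e‖ = 1 := Complex.norm_exp_ofReal_mul_I θ
  have hd : ∀ r : ℝ, HasDerivAt (fun r : ℝ => Φ (r * e)) (fderiv ℝ Φ (r * e) e) r := by
    intro r
    have h1 : HasDerivAt (fun r : ℝ => (r : ℂ) * e) e r := by
      simpa using (Complex.ofRealCLM.hasDerivAt (x := r)).mul_const e
    exact ((hΦ.differentiable one_ne_zero) _).hasFDerivAt.comp_hasDerivAt r h1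
  have hc : Continuous fun r : ℝ => fderiv ℝ Φ (r * e) e := by
    have := hΦ.continuous_fderiv one_ne_zero
    fun_prop
  have hint : IntegrableOn (fun r : ℝ => fderiv ℝ Φ (r * e) e) (Set.Ioi 0) := by
    refine Integrable.mono' hB hc.aestronglyMeasurable
      ((ae_restrict_mem measurableSet_Ioi).mono fun r hr => ?_)
    refine (ContinuousLinearMap.le_opNorm _ _).trans ?_
    have := hΦB (r * e)
    simpa [hen, abs_of_pos (Set.mem_Ioi.1 hr)] using this
  have hlim : Tendsto (fun r : ℝ => Φ (r * e)) atTop (nhds 0) := by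
    refine h0.comp (tendsto_cocompact_of_tendsto_dist_comp_atTop 0 ?_)
    simpa [hen] using tendsto_abs_atTop_atTop
  have := integral_Ioi_of_hasDerivAt_of_tendsto (hd 0).continuousAt.continuousWithinAt
    (fun r _ => hd r) hint hlim
  simpa using this

lemma integral_fderiv_circle {Φ : ℂ → ℂ} (hΦ : ContDiff ℝ 1 Φ) {r : ℝ} (hr : r ≠ 0) :
    ∫ θ in Set.Ioo (-Real.pi) Real.pi, fderiv ℝ Φ (r * Complex.exp (θ * Complex.I))
      (Complex.I * Complex.exp (θ * Complex.I)) = 0 := by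
  have hc : Continuous fun θ : ℝ => fderiv ℝ Φ (r * Complex.exp (θ * Complex.I))
      (Complex.I * Complex.exp (θ * Complex.I)) := by
    have := hΦ.continuous_fderiv one_ne_zero
    fun_prop
  have hd : ∀ θ : ℝ, HasDerivAt (fun θ : ℝ => r⁻¹ • Φ (r * Complex.exp (θ * Complex.I)))
      (fderiv ℝ Φ (r * Complex.exp (θ * Complex.I))
        (Complex.I * Complex.exp (θ * Complex.I))) θ := by
    intro θ
    have h1 : HasDerivAt (fun θ : ℝ => (r : ℂ) * Complex.exp (θ * Complex.I))
        (r • (Complex.I * Complex.exp (θ * Complex.I))) θ := by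
      have h2 : HasDerivAt (fun θ : ℝ => (θ : ℂ) * Complex.I) Complex.I θ := by
        simpa using (Complex.ofRealCLM.hasDerivAt (x := θ)).mul_const Complex.I
      refine (h2.cexp.const_mul (r : ℂ)).congr_deriv ?_
      rw [Complex.real_smul]; ring
    have h3 := (((hΦ.differentiable one_ne_zero) _).hasFDerivAt.comp_hasDerivAt θ h1).const_smul r⁻¹
    rwa [map_smul, smul_smul, inv_mul_cancel₀ hr, one_smul] at h3
  rw [← integral_Ioc_eq_integral_Ioo, ← intervalIntegral.integral_of_le (by linarith [Real.pi_pos]),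
    intervalIntegral.integral_eq_sub_of_hasDerivAt (fun θ _ => hd θ) (hc.intervalIntegrable _ _)]
  simp [Complex.exp_neg]

lemma integral_dbarFun_div {Φ : ℂ → ℂ} (hΦ : ContDiff ℝ 1 Φ)
    (h0 : Tendsto Φ (cocompact ℂ) (nhds 0)) {B : ℝ → ℝ} (hB : IntegrableOn B (Set.Ioi 0))
    (hΦB : ∀ t, ‖fderiv ℝ Φ t‖ ≤ B ‖t‖) :
    ∫ t, dbarFun Φ t / t = -Real.pi * Φ 0 := by
  set E : ℝ → ℂ := fun θ => Complex.exp (θ * Complex.I) with hE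
  have hEn : ∀ θ, ‖E θ‖ = 1 := Complex.norm_exp_ofReal_mul_I
  set μ := (volume : Measure ℝ).restrict (Set.Ioi 0) with hμ
  set ν := (volume : Measure ℝ).restrict (Set.Ioo (-Real.pi) Real.pi) with hν
  have hB' : Integrable (fun p : ℝ × ℝ => B p.1) (μ.prod ν) := Integrable.comp_fst hB ν
  have hpos : ∀ᵐ p ∂(μ.prod ν), 0 < p.1 := by
    rw [hμ, hν, Measure.prod_restrict]
    exact (ae_restrict_mem (measurableSet_Ioi.prod measurableSet_Ioo)).mono fun p hp => hp.1
  have hint : ∀ c : ℂ, ‖c‖ = 1 →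
      Integrable (fun p : ℝ × ℝ => fderiv ℝ Φ (p.1 * E p.2) (c * E p.2)) (μ.prod ν) := by
    intro c hc
    have hcont : Continuous fun p : ℝ × ℝ => fderiv ℝ Φ (p.1 * E p.2) (c * E p.2) := by
      have := hΦ.continuous_fderiv one_ne_zero
      fun_prop
    refine hB'.mono' hcont.aestronglyMeasurable (hpos.mono fun p hp => ?_)
    refine (ContinuousLinearMap.le_opNorm _ _).trans ?_
    have := hΦB (p.1 * E p.2)
    simpa [hEn, hc, abs_of_pos hp] using this
  have hP := hint 1 (by simp)
  have hQ := hint Complex.I (by simp)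
  simp only [one_mul] at hP
  have hPint : ∫ p, fderiv ℝ Φ (p.1 * E p.2) (E p.2) ∂(μ.prod ν) = -(2 * Real.pi) * Φ 0 := by
    rw [integral_prod_symm _ hP]
    simp only [hμ, hE, integral_fderiv_ray hΦ h0 hB hΦB]
    rw [integral_const, hν]
    simp [Measure.real, Real.volume_Ioo, ENNReal.toReal_ofReal, Real.pi_pos.le]
    exact Or.inl (by ring)
  have hQint : ∫ p, fderiv ℝ Φ (p.1 * E p.2) (Complex.I * E p.2) ∂(μ.prod ν) = 0 := by
    rw [integral_prod _ hQ]
    refine integral_eq_zero_of_ae ?_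
    refine (ae_restrict_mem measurableSet_Ioi).mono fun r hr => ?_
    exact integral_fderiv_circle hΦ (ne_of_gt hr)
  rw [← Complex.integral_comp_polarCoord_symm]
  have htgt : (volume : Measure (ℝ × ℝ)).restrict polarCoord.target = μ.prod ν := by
    rw [hμ, hν, Measure.prod_restrict, polarCoord_target, Measure.volume_eq_prod]
  rw [htgt]
  have heq : ∀ᵐ p ∂(μ.prod ν), p.1 • (dbarFun Φ (Complex.polarCoord.symm p) /
      Complex.polarCoord.symm p) = 2⁻¹ * (fderiv ℝ Φ (p.1 * E p.2) (E p.2) +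
        Complex.I * fderiv ℝ Φ (p.1 * E p.2) (Complex.I * E p.2)) := by
    refine hpos.mono fun p hp => ?_
    have h1 : Complex.polarCoord.symm p = p.1 * E p.2 := by
      rw [Complex.polarCoord_symm_apply, hE]; simp [Complex.exp_mul_I]
    rw [h1]
    exact dbarFun_div_exp Φ _ hp.ne' p.2
  rw [integral_congr_ae heq, integral_const_mul, integral_add hP (hQ.const_mul _),
    integral_const_mul, hPint, hQint]
  ring

/-! ### Smooth dependence of integrals on a parameter -/

lemma hasFDerivAt_integral_of_norm_fderiv_le {E F : Type*} [NormedAddCommGroup E]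
    [NormedSpace ℝ E] [NormedAddCommGroup F] [NormedSpace ℝ F] {α : Type*} [MeasurableSpace α]
    {μ : Measure α} {G : α → E → F} (hd : ∀ t, Differentiable ℝ (G t))
    (hm0 : ∀ z, AEStronglyMeasurable (fun t => G t z) μ)
    (hm1 : ∀ z, AEStronglyMeasurable (fun t => fderiv ℝ (G t) z) μ)
    {A : E → ℝ} (hA : Continuous A) {B₀ B₁ : α → ℝ} (hB₀ : Integrable B₀ μ) (hB₁ : Integrable B₁ μ)
    (hB₁0 : ∀ t, 0 ≤ B₁ t) (h0 : ∀ t z, ‖G t z‖ ≤ A z * B₀ t)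
    (h1 : ∀ t z, ‖fderiv ℝ (G t) z‖ ≤ A z * B₁ t) (z : E) :
    HasFDerivAt (fun z => ∫ t, G t z ∂μ) (∫ t, fderiv ℝ (G t) z ∂μ) z := by
  have hs : {w | A w < A z + 1} ∈ nhds z :=
    (isOpen_lt hA continuous_const).mem_nhds (by simp)
  refine hasFDerivAt_integral_of_dominated_of_fderiv_le (F := fun z t => G t z)
    (F' := fun z t => fderiv ℝ (G t) z) (bound := fun t => (A z + 1) * B₁ t) hs
    (Eventually.of_forall hm0) ((hB₀.const_mul (A z)).mono' (hm0 z) (ae_of_all _ fun t => h0 t z))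
    (hm1 z) (ae_of_all _ fun t w hw => (h1 t w).trans ?_) (hB₁.const_mul _)
    (ae_of_all _ fun t w _ => (hd t w).hasFDerivAt)
  exact mul_le_mul_of_nonneg_right (le_of_lt hw) (hB₁0 t)

lemma contDiff_integral_of_norm_iteratedFDeriv_le {E F : Type*} [NormedAddCommGroup E]
    [NormedSpace ℝ E] [NormedAddCommGroup F] [NormedSpace ℝ F] {α : Type*} [MeasurableSpace α]
    {μ : Measure α} {G : α → E → F} (hG : ∀ t, ContDiff ℝ (⊤ : ℕ∞) (G t))
    (hm : ∀ n z, AEStronglyMeasurable (fun t => iteratedFDeriv ℝ n (G t) z) μ)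
    {A : E → ℝ} (hA : Continuous A) {B : ℕ → α → ℝ} (hB : ∀ n, Integrable (B n) μ)
    (hB0 : ∀ n t, 0 ≤ B n t) (h : ∀ n t z, ‖iteratedFDeriv ℝ n (G t) z‖ ≤ A z * B n t) :
    ContDiff ℝ (⊤ : ℕ∞) (fun z => ∫ t, G t z ∂μ) ∧
      ∀ n z, iteratedFDeriv ℝ n (fun z => ∫ t, G t z ∂μ) z
        = ∫ t, iteratedFDeriv ℝ n (G t) z ∂μ := by
  have hstep : ∀ n z, HasFDerivAt (fun z => ∫ t, iteratedFDeriv ℝ n (G t) z ∂μ)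
      (∫ t, fderiv ℝ (iteratedFDeriv ℝ n (G t)) z ∂μ) z := by
    intro n
    refine hasFDerivAt_integral_of_norm_fderiv_le
      (fun t => (hG t).differentiable_iteratedFDeriv (by exact_mod_cast WithTop.coe_lt_top n))
      (hm n) (fun z => ?_) hA (hB n) (hB (n + 1)) (hB0 (n + 1)) (h n) fun t z => ?_
    · have h1 := (continuousMultilinearCurryLeftEquiv ℝ (fun _ : Fin (n + 1) => E)
        F).continuous.comp_aestronglyMeasurable (hm (n + 1) z)
      refine h1.congr (ae_of_all _ fun t => ?_)
      simp [iteratedFDeriv_succ_eq_comp_left]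
    · rw [norm_fderiv_iteratedFDeriv]
      exact h (n + 1) t z
  have heq : ∀ n, iteratedFDeriv ℝ n (fun z => ∫ t, G t z ∂μ)
      = fun z => ∫ t, iteratedFDeriv ℝ n (G t) z ∂μ := by
    intro n
    induction n with
    | zero =>
      ext1 z
      simp only [iteratedFDeriv_zero_eq_comp, Function.comp_apply]
      exact ((continuousMultilinearCurryFin0 ℝ E F).symm.toContinuousLinearEquiv.integral_comp_comm
        (fun t => G t z)).symm
    | succ n ih =>
      ext1 z
      rw [iteratedFDeriv_succ_eq_comp_left, ih]
      simp only [iteratedFDeriv_succ_eq_comp_left, Function.comp_apply]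
      rw [(hstep n z).fderiv]
      let L : (E →L[ℝ] (E [×n]→L[ℝ] F)) ≃L[ℝ] (E [×(n + 1)]→L[ℝ] F) :=
        (continuousMultilinearCurryLeftEquiv ℝ
          (fun _ : Fin (n + 1) => E) F).symm.toContinuousLinearEquiv
      exact (ContinuousLinearEquiv.integral_comp_comm (𝕜 := ℝ) (F := E [×(n + 1)]→L[ℝ] F)
        (μ := μ) L (fun t => fderiv ℝ (iteratedFDeriv ℝ n (G t)) z)).symm
  refine ⟨contDiff_of_differentiable_iteratedFDeriv fun m _ => ?_, fun n z => by rw [heq]⟩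
  rw [heq]
  exact fun z => (hstep m z).differentiableAt

lemma norm_iteratedFDeriv_cexp_comp_le (L : ℂ →L[ℝ] ℂ) (n : ℕ) (z : ℂ) :
    ‖iteratedFDeriv ℝ n (fun z => Complex.exp (L z)) z‖ ≤ ‖L‖ ^ n * ‖Complex.exp (L z)‖ := by
  induction n with
  | zero => simp
  | succ n ih =>
    have hfd : fderiv ℝ (fun z => Complex.exp (L z))
        = ((ContinuousLinearMap.compL ℝ ℂ ℂ ℂ).flip L ∘L ContinuousLinearMap.mul ℝ ℂ) ∘
          fun z => Complex.exp (L z) := by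
      ext1 w
      rw [L.hasFDerivAt.cexp.fderiv]
      ext v
      simp
    have hsm : ContDiff ℝ (⊤ : ℕ∞) fun z => Complex.exp (L z) := L.contDiff.cexp
    have hn : ‖(ContinuousLinearMap.compL ℝ ℂ ℂ ℂ).flip L ∘L ContinuousLinearMap.mul ℝ ℂ‖
        ≤ ‖L‖ :=
      ContinuousLinearMap.opNorm_le_bound _ (norm_nonneg _) fun c =>
        (ContinuousLinearMap.opNorm_comp_le _ _).trans_eq (by simp [mul_comm])
    rw [← norm_iteratedFDeriv_fderiv, hfd]
    refine (ContinuousLinearMap.norm_iteratedFDeriv_comp_left _ hsm.contDiffAt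
      (by exact_mod_cast le_top)).trans ?_
    calc _ ≤ ‖L‖ * (‖L‖ ^ n * ‖Complex.exp (L z)‖) := by gcongr
      _ = _ := by ring

lemma continuous_iteratedFDeriv_left {E E' F : Type*} [NormedAddCommGroup E] [NormedSpace ℝ E]
    [NormedAddCommGroup E'] [NormedSpace ℝ E'] [NormedAddCommGroup F] [NormedSpace ℝ F]
    {H : E × E' → F} (hH : ContDiff ℝ (⊤ : ℕ∞) H) (n : ℕ) (z : E) :
    Continuous fun t => iteratedFDeriv ℝ n (fun z => H (z, t)) z := by
  have h1 : ∀ t, iteratedFDeriv ℝ n (fun z => H (z, t)) z =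
      (iteratedFDeriv ℝ n H (z, t)).compContinuousLinearMap
        fun _ => ContinuousLinearMap.inl ℝ E E' := by
    intro t
    have h2 : (fun z => H (z, t)) =
        (fun p => H (p + (0, t))) ∘ ContinuousLinearMap.inl ℝ E E' := by
      ext; simp
    have h3 : ContDiff ℝ (⊤ : ℕ∞) fun p => H (p + (0, t)) := by fun_prop
    rw [h2, ContinuousLinearMap.iteratedFDeriv_comp_right _ h3 _ (by exact_mod_cast le_top),
      iteratedFDeriv_comp_add_right]
    simp
  simp only [h1]
  exact (ContinuousMultilinearMap.compContinuousLinearMapL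
    (fun _ => ContinuousLinearMap.inl ℝ E E')).continuous.comp
    ((hH.continuous_iteratedFDeriv (m := n) (by exact_mod_cast le_top)).comp (by fun_prop))

/-! ### A solution operator for `∂̄` on Gaussian weights -/

/-- The integrand of the solution operator for `∂̄` adapted to the weight `exp (a|z|²)`. -/
def dbarKernel (a : ℝ) (f : ℂ → ℂ) (t z : ℂ) : ℂ :=
  ((Real.exp (-(2 * a * ‖t‖ ^ 2)) : ℂ) / (Real.pi * t)) *
    (f (z - t) * Complex.exp (2 * a * t * (starRingEnd ℂ) z))

/-- The solution operator for `∂̄` adapted to the weight `exp (a|z|²)`. -/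
def dbarSol (a : ℝ) (f : ℂ → ℂ) (z : ℂ) : ℂ := ∫ t, dbarKernel a f t z

/-- The majorant of the `n`-th derivative of the kernel. -/
def dbarMajorant (a : ℝ) (n : ℕ) (t : ℂ) : ℝ :=
  (1 + 2 * a * ‖t‖) ^ n * Real.exp (-(a * ‖t‖ ^ 2)) * (Real.pi * ‖t‖)⁻¹

lemma dbarMajorant_nonneg {a : ℝ} (ha : 0 ≤ a) (n : ℕ) (t : ℂ) : 0 ≤ dbarMajorant a n t := by
  have := Real.pi_pos
  unfold dbarMajorant
  positivity

lemma weight_mul_norm_cexp (a : ℝ) (t z : ℂ) :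
    Real.exp (a * ‖z - t‖ ^ 2) * ‖Complex.exp (2 * a * t * (starRingEnd ℂ) z)‖
      = Real.exp (a * ‖z‖ ^ 2) * Real.exp (a * ‖t‖ ^ 2) := by
  rw [Complex.norm_exp, ← Real.exp_add, ← Real.exp_add]
  congr 1
  simp only [← Complex.normSq_eq_norm_sq, Complex.normSq_apply]
  simp
  ring

lemma norm_iteratedFDeriv_dbarKernel_le {a M : ℝ} {n : ℕ} {f : ℂ → ℂ} (ha : 0 ≤ a)
    (hf : ContDiff ℝ (⊤ : ℕ∞) f)
    (hM : ∀ i ≤ n, ∀ w, ‖iteratedFDeriv ℝ i f w‖ ≤ M * Real.exp (a * ‖w‖ ^ 2)) (t z : ℂ) :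
    ‖iteratedFDeriv ℝ n (dbarKernel a f t) z‖
      ≤ M * Real.exp (a * ‖z‖ ^ 2) * dbarMajorant a n t := by
  let L : ℂ →L[ℝ] ℂ := (2 * a * t) • (Complex.conjCLE : ℂ →L[ℝ] ℂ)
  have hL : ‖L‖ ≤ 2 * a * ‖t‖ := by
    refine (norm_smul_le (2 * a * t) (Complex.conjCLE : ℂ →L[ℝ] ℂ)).trans_eq ?_
    rw [Complex.conjCLE_norm]
    simp [abs_of_nonneg ha]
  have hLz : ∀ z, L z = 2 * a * t * (starRingEnd ℂ) z := fun z => by simp [L]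
  have hk : dbarKernel a f t = ((Real.exp (-(2 * a * ‖t‖ ^ 2)) : ℂ) / (Real.pi * t)) •
      fun z => f (z - t) * Complex.exp (L z) := by
    ext z
    simp only [dbarKernel, hLz, smul_eq_mul, Pi.smul_apply]
  have h1 : ContDiff ℝ (⊤ : ℕ∞) fun z => f (z - t) := by fun_prop
  have h2 : ContDiff ℝ (⊤ : ℕ∞) fun z => Complex.exp (L z) := L.contDiff.cexp
  have hkn : ‖((Real.exp (-(2 * a * ‖t‖ ^ 2)) : ℂ) / (Real.pi * t))‖
      = Real.exp (-(2 * a * ‖t‖ ^ 2)) * (Real.pi * ‖t‖)⁻¹ := by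
    rw [norm_div, norm_mul, Complex.norm_real, Complex.norm_real, Real.norm_of_nonneg
      (Real.exp_pos _).le, Real.norm_of_nonneg Real.pi_pos.le, div_eq_mul_inv]
  have hsum : ‖iteratedFDeriv ℝ n (fun z => f (z - t) * Complex.exp (L z)) z‖
      ≤ M * (1 + 2 * a * ‖t‖) ^ n * (Real.exp (a * ‖z‖ ^ 2) * Real.exp (a * ‖t‖ ^ 2)) := by
    refine (norm_iteratedFDeriv_mul_le h1 h2 z (n := n) (by exact_mod_cast le_top)).trans ?_
    rw [add_pow, Finset.mul_sum, Finset.sum_mul]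
    refine Finset.sum_le_sum fun i hi => ?_
    have hi' : i ≤ n := Nat.lt_succ_iff.1 (Finset.mem_range.1 hi)
    rw [iteratedFDeriv_comp_sub, ← weight_mul_norm_cexp, ← hLz]
    calc _ ≤ (n.choose i : ℝ) * (M * Real.exp (a * ‖z - t‖ ^ 2)) *
          ((2 * a * ‖t‖) ^ (n - i) * ‖Complex.exp (L z)‖) := by
          gcongr
          · exact mul_nonneg (Nat.cast_nonneg _) ((norm_nonneg _).trans (hM i hi' (z - t)))
          · exact hM i hi' _
          · exact (norm_iteratedFDeriv_cexp_comp_le L _ z).trans (by gcongr)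
      _ = _ := by ring
  rw [hk, iteratedFDeriv_const_smul_apply ((h1.mul h2).of_le (by exact_mod_cast le_top)).contDiffAt,
    norm_smul, hkn]
  calc _ ≤ Real.exp (-(2 * a * ‖t‖ ^ 2)) * (Real.pi * ‖t‖)⁻¹ *
        (M * (1 + 2 * a * ‖t‖) ^ n * (Real.exp (a * ‖z‖ ^ 2) * Real.exp (a * ‖t‖ ^ 2))) := by
        gcongr
    _ = M * (1 + 2 * a * ‖t‖) ^ n * (Real.pi * ‖t‖)⁻¹ * Real.exp (a * ‖z‖ ^ 2) *
        (Real.exp (-(2 * a * ‖t‖ ^ 2)) * Real.exp (a * ‖t‖ ^ 2)) := by ring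
    _ = _ := by
      rw [← Real.exp_add, dbarMajorant,
        show -(2 * a * ‖t‖ ^ 2) + a * ‖t‖ ^ 2 = -(a * ‖t‖ ^ 2) by ring]
      ring

lemma integrable_exp_neg_mul_sq_mul_inv_norm {b : ℝ} (hb : 0 < b) :
    Integrable fun t : ℂ => Real.exp (-(b * ‖t‖ ^ 2)) * ‖t‖⁻¹ := by
  have h := Complex.integral_rpow_mul_exp_neg_mul_rpow (p := 2) (q := -1) (b := b)
    (by norm_num) (by norm_num) hb
  have h2 : Integrable fun t : ℂ => ‖t‖ ^ (-1 : ℝ) * Real.exp (-b * ‖t‖ ^ (2 : ℝ)) := by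
    by_contra hc
    rw [integral_undef hc] at h
    refine absurd h (ne_of_lt ?_)
    have := Real.Gamma_pos_of_pos (s := (-1 + 2) / 2) (by norm_num)
    have := Real.rpow_pos_of_pos hb (-(-1 + 2) / 2)
    have := Real.pi_pos
    positivity
  refine h2.congr (ae_of_all _ fun t => ?_)
  simp [Real.rpow_neg_one, mul_comm]

lemma integrable_dbarMajorant {a : ℝ} (ha : 0 < a) (n : ℕ) : Integrable (dbarMajorant a n) := by
  obtain ⟨A, hA⟩ := exists_pow_le_mul_exp_sq (b := (16 * a)⁻¹) (by positivity) n
  have hA0 : 0 ≤ A := by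
    have := hA 1 zero_le_one
    rw [one_pow] at this
    exact (pos_of_mul_pos_left (zero_lt_one.trans_le this) (Real.exp_pos _).le).le
  refine ((integrable_exp_neg_mul_sq_mul_inv_norm (half_pos ha)).const_mul
    (A * Real.exp (8 * a)⁻¹ * Real.pi⁻¹)).mono' ?_ (ae_of_all _ fun t => ?_)
  · unfold dbarMajorant
    exact Measurable.aestronglyMeasurable (by fun_prop)
  · rw [Real.norm_of_nonneg (dbarMajorant_nonneg ha.le n t), dbarMajorant]
    have h1 : (1 + 2 * a * ‖t‖) ^ n ≤ A * (Real.exp (8 * a)⁻¹ * Real.exp (a / 2 * ‖t‖ ^ 2)) := by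
      refine (hA _ (by positivity)).trans ?_
      rw [← Real.exp_add]
      gcongr
      rw [inv_mul_le_iff₀ (by positivity)]
      have : 16 * a * ((8 * a)⁻¹ + a / 2 * ‖t‖ ^ 2) = 2 + 8 * a ^ 2 * ‖t‖ ^ 2 := by
        field_simp
        ring
      rw [this]
      nlinarith [sq_nonneg (1 - 2 * a * ‖t‖)]
    have h2 : Real.exp (a / 2 * ‖t‖ ^ 2) * Real.exp (-(a * ‖t‖ ^ 2))
        = Real.exp (-(a / 2 * ‖t‖ ^ 2)) := by
      rw [← Real.exp_add]
      ring_nf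
    have hpi := Real.pi_pos
    calc _ ≤ A * (Real.exp (8 * a)⁻¹ * Real.exp (a / 2 * ‖t‖ ^ 2)) *
          Real.exp (-(a * ‖t‖ ^ 2)) * (Real.pi * ‖t‖)⁻¹ := by gcongr
      _ = A * Real.exp (8 * a)⁻¹ * (Real.exp (a / 2 * ‖t‖ ^ 2) * Real.exp (-(a * ‖t‖ ^ 2))) *
          (Real.pi * ‖t‖)⁻¹ := by ring
      _ = _ := by rw [h2, mul_inv]; ring

lemma aestronglyMeasurable_iteratedFDeriv_dbarKernel (a : ℝ) {f : ℂ → ℂ}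
    (hf : ContDiff ℝ (⊤ : ℕ∞) f) (n : ℕ) (z : ℂ) :
    AEStronglyMeasurable (fun t => iteratedFDeriv ℝ n (dbarKernel a f t) z) := by
  have hconj : ContDiff ℝ (⊤ : ℕ∞) fun z : ℂ => (starRingEnd ℂ) z := Complex.conjCLE.contDiff
  let H : ℂ × ℂ → ℂ := fun p => f (p.1 - p.2) * Complex.exp (2 * a * p.2 * (starRingEnd ℂ) p.1)
  have hH : ContDiff ℝ (⊤ : ℕ∞) H :=
    (hf.comp (contDiff_fst.sub contDiff_snd)).mul
      ((contDiff_const.mul contDiff_snd).mul (hconj.comp contDiff_fst)).cexp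
  have h1 : ∀ t, iteratedFDeriv ℝ n (dbarKernel a f t) z
      = ((Real.exp (-(2 * a * ‖t‖ ^ 2)) : ℂ) / (Real.pi * t)) •
        iteratedFDeriv ℝ n (fun z => H (z, t)) z := by
    intro t
    have h2 : ContDiff ℝ (⊤ : ℕ∞) fun z => H (z, t) := hH.comp (contDiff_id.prodMk contDiff_const)
    rw [← iteratedFDeriv_const_smul_apply (h2.of_le (by exact_mod_cast le_top)).contDiffAt]
    rfl
  simp only [h1]
  have hk : Measurable fun t : ℂ => (Real.exp (-(2 * a * ‖t‖ ^ 2)) : ℂ) / (Real.pi * t) := by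
    fun_prop
  exact hk.aestronglyMeasurable.smul
    (continuous_iteratedFDeriv_left hH n z).aestronglyMeasurable

lemma contDiff_dbarKernel (a : ℝ) {f : ℂ → ℂ} (hf : ContDiff ℝ (⊤ : ℕ∞) f) (t : ℂ) :
    ContDiff ℝ (⊤ : ℕ∞) (dbarKernel a f t) := by
  have hconj : ContDiff ℝ (⊤ : ℕ∞) fun z : ℂ => (starRingEnd ℂ) z := Complex.conjCLE.contDiff
  exact contDiff_const.mul ((hf.comp (contDiff_id.sub contDiff_const)).mul
    (contDiff_const.mul hconj).cexp)

lemma MemDq.norm_iteratedFDeriv_dbarKernel_le {a : ℝ} (ha : 0 < a) {f : ℂ → ℂ} (hf : MemDq a f)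
    {n l : ℕ} (hn : n ≤ l) (t z : ℂ) :
    ‖iteratedFDeriv ℝ n (dbarKernel a f t) z‖
      ≤ lambdaNorm a l f * Real.exp (a * ‖z‖ ^ 2) * dbarMajorant a n t :=
  _root_.norm_iteratedFDeriv_dbarKernel_le ha.le hf.1
    (fun _ hi => hf.norm_iteratedFDeriv_le (hi.trans hn)) t z

lemma MemDq.contDiff_dbarSol {a : ℝ} (ha : 0 < a) {f : ℂ → ℂ} (hf : MemDq a f) :
    ContDiff ℝ (⊤ : ℕ∞) (dbarSol a f) ∧
      ∀ n z, iteratedFDeriv ℝ n (dbarSol a f) z = ∫ t, iteratedFDeriv ℝ n (dbarKernel a f t) z :=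
  contDiff_integral_of_norm_iteratedFDeriv_le (A := fun z => Real.exp (a * ‖z‖ ^ 2))
    (B := fun n t => lambdaNorm a n f * dbarMajorant a n t) (contDiff_dbarKernel a hf.1)
    (aestronglyMeasurable_iteratedFDeriv_dbarKernel a hf.1) (by fun_prop)
    (fun n => (integrable_dbarMajorant ha n).const_mul _)
    (fun n t => mul_nonneg (lambdaNorm_nonneg _ _ _) (dbarMajorant_nonneg ha.le n t))
    fun n t z => (hf.norm_iteratedFDeriv_dbarKernel_le ha le_rfl t z).trans_eq (by ring)

lemma MemDq.norm_iteratedFDeriv_dbarSol_le {a : ℝ} (ha : 0 < a) {f : ℂ → ℂ} (hf : MemDq a f)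
    {n l : ℕ} (hn : n ≤ l) (z : ℂ) :
    ‖iteratedFDeriv ℝ n (dbarSol a f) z‖
      ≤ (∫ t, dbarMajorant a n t) * lambdaNorm a l f * Real.exp (a * ‖z‖ ^ 2) := by
  rw [(hf.contDiff_dbarSol ha).2]
  refine (norm_integral_le_of_norm_le ((integrable_dbarMajorant ha n).const_mul _)
    (ae_of_all _ fun t => hf.norm_iteratedFDeriv_dbarKernel_le ha hn t z)).trans_eq ?_
  rw [integral_const_mul]
  ring

lemma MemDq.dbarSol {a q : ℝ} (ha : 0 < a) (haq : a < q) {f : ℂ → ℂ} (hf : MemDq a f) :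
    MemDq q (dbarSol a f) :=
  MemDq.of_le haq (hf.contDiff_dbarSol ha).1 fun _ =>
    ⟨_, hf.norm_iteratedFDeriv_dbarSol_le ha le_rfl⟩

lemma exists_lambdaNorm_dbarSol_le {a q : ℝ} (ha : 0 < a) (haq : a ≤ q) (l : ℕ) :
    ∃ K, 0 ≤ K ∧ ∀ f, MemDq a f → lambdaNorm q l (dbarSol a f) ≤ K * lambdaNorm a l f := by
  have h0 : ∀ n, 0 ≤ ∫ t, dbarMajorant a n t := fun n =>
    integral_nonneg fun t => dbarMajorant_nonneg ha.le n t
  refine ⟨∑ n ∈ Finset.range (l + 1), ∫ t, dbarMajorant a n t,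
    Finset.sum_nonneg fun n _ => h0 n, fun f hf => ?_⟩
  have hl := lambdaNorm_nonneg a l f
  refine lambdaNorm_le (mul_nonneg (Finset.sum_nonneg fun n _ => h0 n) hl) fun n hn z =>
    (hf.norm_iteratedFDeriv_dbarSol_le ha hn z).trans ?_
  have hexp := Real.exp_pos (a * ‖z‖ ^ 2)
  have hz : Real.exp (a * ‖z‖ ^ 2) ≤ Real.exp (q * ‖z‖ ^ 2) := by gcongr
  refine mul_le_mul (mul_le_mul_of_nonneg_right ?_ hl) hz hexp.le
    (mul_nonneg (Finset.sum_nonneg fun n _ => h0 n) hl)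
  exact Finset.single_le_sum (f := fun n => ∫ t, dbarMajorant a n t) (fun n _ => h0 n)
      (Finset.mem_range.2 (Nat.lt_succ_of_le hn))

lemma dbarFun_eq_of_hasFDerivAt {ψ : ℂ → ℂ} {L : ℂ →L[ℝ] ℂ} {z : ℂ} (h : HasFDerivAt ψ L z) :
    dbarFun ψ z = (L 1 + Complex.I * L Complex.I) / 2 := by
  rw [dbarFun, h.fderiv]

lemma dbarFun_dbarSol_eq_integral {a : ℝ} (ha : 0 < a) {f : ℂ → ℂ} (hf : MemDq a f) (z : ℂ) :
    dbarFun (dbarSol a f) z = ∫ t, dbarFun (dbarKernel a f t) z := by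
  have hint : Integrable fun t => iteratedFDeriv ℝ 1 (dbarKernel a f t) z :=
    ((integrable_dbarMajorant ha 1).const_mul _).mono'
      (aestronglyMeasurable_iteratedFDeriv_dbarKernel a hf.1 1 z)
      (ae_of_all _ fun t => hf.norm_iteratedFDeriv_dbarKernel_le ha le_rfl t z)
  have hint' : ∀ v : ℂ, Integrable fun t => fderiv ℝ (dbarKernel a f t) z v := fun v => by
    simpa using (ContinuousMultilinearMap.apply ℝ (fun _ : Fin 1 => ℂ) ℂ
      fun _ => v).integrable_comp hint
  have hv : ∀ v : ℂ, fderiv ℝ (dbarSol a f) z v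
      = ∫ t, fderiv ℝ (dbarKernel a f t) z v := fun v => by
    have h1 := (ContinuousMultilinearMap.apply ℝ (fun _ : Fin 1 => ℂ) ℂ
      fun _ => v).integral_comp_comm hint
    rw [← (hf.contDiff_dbarSol ha).2] at h1
    simpa using h1.symm
  simp only [dbarFun]
  rw [integral_div, integral_add (hint' _) ((hint' _).const_mul _), integral_const_mul, hv, hv]

/-- The function of `t` whose `∂̄`-derivative produces the derivative of the kernel. -/
def dbarProfile (a : ℝ) (f : ℂ → ℂ) (z t : ℂ) : ℂ :=
  f (z - t) * Complex.exp (2 * a * t * (starRingEnd ℂ) (z - t))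

lemma dbarFun_dbarKernel (a : ℝ) {f : ℂ → ℂ} (hf : Differentiable ℝ f) (t z : ℂ) :
    dbarFun (dbarKernel a f t) z = -(Real.pi : ℂ)⁻¹ * (dbarFun (dbarProfile a f z) t / t) := by
  have hconj : ∀ w : ℂ, HasFDerivAt (fun w : ℂ => (starRingEnd ℂ) w)
      (Complex.conjCLE : ℂ →L[ℝ] ℂ) w := fun w => Complex.conjCLE.hasFDerivAt
  have hid : ∀ w : ℂ, HasFDerivAt (fun w : ℂ => w) (ContinuousLinearMap.id ℝ ℂ) w :=
    fun w => hasFDerivAt_id w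
  have h1 := (((hf (z - t)).hasFDerivAt.comp z ((hid z).sub_const t)).mul
    ((hconj z).const_mul (2 * a * t : ℂ)).cexp).const_mul
      ((Real.exp (-(2 * a * ‖t‖ ^ 2)) : ℂ) / (Real.pi * t))
  have h2 := ((hf (z - t)).hasFDerivAt.comp t ((hid t).const_sub z)).mul
    (((hid t).const_mul (2 * a : ℂ)).mul ((hconj (z - t)).comp t ((hid t).const_sub z))).cexp
  rw [dbarFun_eq_of_hasFDerivAt (ψ := dbarKernel a f t) h1,
    dbarFun_eq_of_hasFDerivAt (ψ := dbarProfile a f z) h2]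
  have hE : Complex.exp (2 * a * t * (starRingEnd ℂ) (z - t))
      = Real.exp (-(2 * a * ‖t‖ ^ 2)) * Complex.exp (2 * a * t * (starRingEnd ℂ) z) := by
    rw [Complex.ofReal_exp, ← Complex.exp_add]
    congr 1
    push_cast
    rw [← Complex.mul_conj' t, map_sub]
    ring
  rcases eq_or_ne t 0 with rfl | ht
  · simp
  have hpi : (Real.pi : ℂ) ≠ 0 := by exact_mod_cast Real.pi_ne_zero
  simp
  simp [map_sub] at hE
  rw [hE]
  field_simp
  ring_nf
  simp
  ring

lemma weight_mul_norm_cexp_profile (a : ℝ) (t z : ℂ) :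
    Real.exp (a * ‖z - t‖ ^ 2) * ‖Complex.exp (2 * a * t * (starRingEnd ℂ) (z - t))‖
      = Real.exp (a * ‖z‖ ^ 2) * Real.exp (-a * ‖t‖ ^ 2) := by
  rw [Complex.norm_exp, ← Real.exp_add, ← Real.exp_add]
  congr 1
  simp only [← Complex.normSq_eq_norm_sq, Complex.normSq_apply]
  simp
  ring

lemma MemDq.norm_dbarProfile_le {a : ℝ} {f : ℂ → ℂ} (hf : MemDq a f) (z t : ℂ) :
    ‖dbarProfile a f z t‖
      ≤ lambdaNorm a 0 f * Real.exp (a * ‖z‖ ^ 2) * Real.exp (-a * ‖t‖ ^ 2) := by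
  rw [dbarProfile, norm_mul]
  have h := hf.norm_iteratedFDeriv_le (le_refl 0) (z - t)
  rw [norm_iteratedFDeriv_zero] at h
  refine (mul_le_mul_of_nonneg_right h (norm_nonneg _)).trans_eq ?_
  rw [mul_assoc, weight_mul_norm_cexp_profile, mul_assoc]

lemma MemDq.norm_fderiv_dbarProfile_le {a : ℝ} (ha : 0 ≤ a) {f : ℂ → ℂ} (hf : MemDq a f)
    (z t : ℂ) : ‖fderiv ℝ (dbarProfile a f z) t‖ ≤ lambdaNorm a 1 f * Real.exp (a * ‖z‖ ^ 2) *
      ((1 + 2 * a * (2 * ‖t‖ + ‖z‖)) * Real.exp (-a * ‖t‖ ^ 2)) := by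
  have hconj : ∀ w : ℂ, HasFDerivAt (fun w : ℂ => (starRingEnd ℂ) w)
      (Complex.conjCLE : ℂ →L[ℝ] ℂ) w := fun w => Complex.conjCLE.hasFDerivAt
  have hid : HasFDerivAt (fun w : ℂ => w) (ContinuousLinearMap.id ℝ ℂ) t := hasFDerivAt_id t
  have h2 := ((hf.differentiable (z - t)).hasFDerivAt.comp t (hid.const_sub z)).mul
    ((hid.const_mul (2 * a : ℂ)).mul ((hconj (z - t)).comp t (hid.const_sub z))).cexp
  have h3 := HasFDerivAt.fderiv (f := dbarProfile a f z) h2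
  have hf0 := hf.norm_iteratedFDeriv_le zero_le_one (z - t)
  have hf1 := hf.norm_iteratedFDeriv_le (le_refl 1) (z - t)
  rw [norm_iteratedFDeriv_zero] at hf0
  rw [norm_iteratedFDeriv_one] at hf1
  have hl := lambdaNorm_nonneg a 1 f
  have hzt : ‖z - t‖ ≤ ‖z‖ + ‖t‖ := norm_sub_le _ _
  refine ContinuousLinearMap.opNorm_le_bound _ (by positivity) fun v => ?_
  rw [h3]
  simp only [Function.comp_apply, _root_.add_apply, _root_.smul_apply,
    ContinuousLinearMap.comp_apply, _root_.neg_apply, ContinuousLinearMap.id_apply,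
    smul_eq_mul, ContinuousLinearEquiv.coe_coe, Complex.conjCLE_apply]
  set E := Complex.exp (2 * a * t * (starRingEnd ℂ) (z - t)) with hE
  have hw := weight_mul_norm_cexp_profile a t z
  rw [← hE] at hw
  have hA : ‖2 * (a : ℂ) * t * (starRingEnd ℂ) (-v) + (starRingEnd ℂ) (z - t) * (2 * a * v)‖
      ≤ 2 * a * (2 * ‖t‖ + ‖z‖) * ‖v‖ := by
    refine (norm_add_le _ _).trans ?_
    simp only [norm_mul, RCLike.norm_conj, norm_neg, Complex.norm_real, Complex.norm_ofNat,
      Real.norm_of_nonneg ha]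
    calc _ ≤ 2 * a * ‖t‖ * ‖v‖ + (‖z‖ + ‖t‖) * (2 * a * ‖v‖) := by gcongr
      _ = _ := by ring
  have hB : ‖fderiv ℝ f (z - t) (-v)‖ ≤ lambdaNorm a 1 f * Real.exp (a * ‖z - t‖ ^ 2) * ‖v‖ := by
    refine ((fderiv ℝ f (z - t)).le_opNorm _).trans ?_
    rw [norm_neg]
    gcongr
  change ‖f (z - t) * (E * _) + E * _‖ ≤ _
  set S := 2 * (a : ℂ) * t * (starRingEnd ℂ) (-v) + (starRingEnd ℂ) (z - t) * (2 * a * v)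
  refine (norm_add_le _ _).trans ?_
  rw [norm_mul, norm_mul, norm_mul]
  calc _ ≤ lambdaNorm a 1 f * Real.exp (a * ‖z - t‖ ^ 2) *
          (‖E‖ * (2 * a * (2 * ‖t‖ + ‖z‖) * ‖v‖)) +
        ‖E‖ * (lambdaNorm a 1 f * Real.exp (a * ‖z - t‖ ^ 2) * ‖v‖) := by gcongr
    _ = lambdaNorm a 1 f * (Real.exp (a * ‖z - t‖ ^ 2) * ‖E‖) *
        (1 + 2 * a * (2 * ‖t‖ + ‖z‖)) * ‖v‖ := by ring
    _ = _ := by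
      rw [hw]
      ring

lemma dbarFun_dbarSol {a : ℝ} (ha : 0 < a) {f : ℂ → ℂ} (hf : MemDq a f) :
    dbarFun (dbarSol a f) = f := by
  ext1 z
  have hconj : ContDiff ℝ (⊤ : ℕ∞) fun z : ℂ => (starRingEnd ℂ) z := Complex.conjCLE.contDiff
  have hsub : ContDiff ℝ (⊤ : ℕ∞) fun t : ℂ => z - t := contDiff_const.sub contDiff_id
  have hc : ContDiff ℝ (⊤ : ℕ∞) (dbarProfile a f z) :=
    (hf.1.comp hsub).mul ((contDiff_const.mul contDiff_id).mul (hconj.comp hsub)).cexp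
  have h0 : Tendsto (dbarProfile a f z) (cocompact ℂ) (nhds 0) := by
    refine squeeze_zero_norm (hf.norm_dbarProfile_le z) ?_
    simpa using (tendsto_exp_neg_mul_sq_cocompact ha).const_mul
      (lambdaNorm a 0 f * Real.exp (a * ‖z‖ ^ 2))
  have hB : IntegrableOn (fun r : ℝ => lambdaNorm a 1 f * Real.exp (a * ‖z‖ ^ 2) *
      ((1 + 2 * a * (2 * r + ‖z‖)) * Real.exp (-a * r ^ 2))) (Set.Ioi 0) := by
    refine Integrable.integrableOn (Integrable.const_mul ?_ _)
    refine (((integrable_exp_neg_mul_sq ha).const_mul (1 + 2 * a * ‖z‖)).add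
      ((integrable_mul_exp_neg_mul_sq ha).const_mul (4 * a))).congr (ae_of_all _ fun r => ?_)
    simp only [Pi.add_apply]
    ring
  have hd : Differentiable ℝ f := hf.differentiable
  rw [dbarFun_dbarSol_eq_integral ha hf]
  simp only [dbarFun_dbarKernel a hd]
  rw [integral_const_mul, integral_dbarFun_div (hc.of_le (by exact_mod_cast le_top)) h0 hB
    (hf.norm_fderiv_dbarProfile_le ha.le z)]
  have hpi : (Real.pi : ℂ) ≠ 0 := by exact_mod_cast Real.pi_ne_zero
  simp [dbarProfile, hpi]

/-! ### Solving `∂̄g = h` by duality -/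

lemma differentiable_complex_of_dbarFun_eq_zero {u : ℂ → ℂ} (hu : Differentiable ℝ u)
    (h : dbarFun u = 0) : Differentiable ℂ u := by
  intro z
  refine differentiableAt_complex_iff_differentiableAt_real.2 ⟨hu z, ?_⟩
  have h1 : (fderiv ℝ u z 1 + Complex.I * fderiv ℝ u z Complex.I) / 2 = 0 := congrFun h z
  have h2 : fderiv ℝ u z 1 + Complex.I * fderiv ℝ u z Complex.I = 0 := by simpa using h1
  rw [smul_eq_mul]
  linear_combination (-Complex.I) * h2 + fderiv ℝ u z Complex.I * Complex.I_mul_I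

lemma dbarFun_eq_zero_of_differentiable {u : ℂ → ℂ} (hu : Differentiable ℂ u) :
    dbarFun u = 0 := by
  ext z
  have h := (differentiableAt_complex_iff_differentiableAt_real.1 (hu z)).2
  rw [smul_eq_mul] at h
  rw [dbarFun, h, ← mul_assoc, Complex.I_mul_I]
  simp

lemma MemDqDual.map_sub_dbarSol_eq_zero {a q : ℝ} (ha : 0 < a) (haq : a < q) {T : Dst}
    (hT : MemDqDual q T) (h0 : ∀ k : ℕ, T (fun z => z ^ k) = 0) {ψ : ℂ → ℂ} (hψ : MemDq a ψ) :
    T (ψ + (-1 : ℂ) • dbarSol a (dbarFun ψ)) = 0 := by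
  have hf := hψ.dbarFun
  have hs : Differentiable ℝ (dbarSol a (dbarFun ψ)) :=
    (hf.contDiff_dbarSol ha).1.differentiable (by simp)
  have hu : Differentiable ℂ (ψ + (-1 : ℂ) • dbarSol a (dbarFun ψ)) := by
    refine differentiable_complex_of_dbarFun_eq_zero
      (hψ.differentiable.add (hs.const_smul (-1 : ℂ))) ?_
    rw [dbarFun_add hψ.differentiable (hs.const_smul (-1 : ℂ)), dbarFun_const_smul hs,
      dbarFun_dbarSol ha hf]
    simp
  refine hT.map_entire_eq_zero ha haq h0 hu (A := lambdaNorm a 0 ψ +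
    (∫ t, dbarMajorant a 0 t) * lambdaNorm a 0 (dbarFun ψ)) fun z => ?_
  have h1 := hψ.norm_iteratedFDeriv_le (le_refl 0) z
  have h2 := hf.norm_iteratedFDeriv_dbarSol_le ha (le_refl 0) z
  rw [norm_iteratedFDeriv_zero] at h1 h2
  rw [add_mul]
  refine (norm_add_le _ _).trans (add_le_add h1 ?_)
  simpa using h2

lemma MemDqDual.exists_bound_dbarFun {a q : ℝ} (ha : 0 < a) (haq : a < q) {T : Dst}
    (hT : MemDqDual q T) (h0 : ∀ k : ℕ, T (fun z => z ^ k) = 0) :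
    ∃ (l : ℕ) (C : ℝ), 0 ≤ C ∧ ∀ ψ, MemDq a ψ → ‖T ψ‖ ≤ C * lambdaNorm a l (dbarFun ψ) := by
  obtain ⟨l, C, hC0, hC⟩ := hT.exists_bound
  obtain ⟨K, hK0, hK⟩ := exists_lambdaNorm_dbarSol_le ha haq.le l
  refine ⟨l, C * K, mul_nonneg hC0 hK0, fun ψ hψ => ?_⟩
  have hs : MemDq q (dbarSol a (dbarFun ψ)) := hψ.dbarFun.dbarSol ha haq
  have h1 := hT.map_sub_dbarSol_eq_zero ha haq h0 hψ
  rw [hT.1 _ _ (hψ.mono haq) (hs.const_smul _), hT.2.1 _ _ hs, neg_one_mul,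
    ← sub_eq_add_neg, sub_eq_zero] at h1
  rw [h1, mul_assoc]
  exact (hC _ hs).trans (mul_le_mul_of_nonneg_left (hK _ hψ.dbarFun) hC0)

lemma exists_dual_comp_eq_of_le_seminorm {V : Type*} [AddCommGroup V] [Module ℂ V]
    (d : V →ₗ[ℂ] V) (H : Module.Dual ℂ V) (p : Seminorm ℂ V) (hp : ∀ x, ‖H x‖ ≤ p (d x)) :
    ∃ g : Module.Dual ℂ V, (∀ x, g (d x) = H x) ∧ ∀ x, ‖g x‖ ≤ p x := by
  have hker : H ∈ d.ker.dualAnnihilator := by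
    rw [Submodule.mem_dualAnnihilator]
    intro x hx
    have h := hp x
    rw [LinearMap.mem_ker.1 hx, map_zero] at h
    exact norm_le_zero_iff.1 h
  rw [← LinearMap.range_dualMap_eq_dualAnnihilator_ker] at hker
  obtain ⟨g, rfl⟩ := hker
  obtain ⟨g', hg', hle⟩ := Module.Dual.exists_extension_of_le_seminorm d.range
    (g.comp d.range.subtype) (p := p) (by rintro ⟨_, x, rfl⟩; exact hp x)
  exact ⟨g', fun x => hg' ⟨d x, x, rfl⟩, hle⟩

/-- `𝔇_q` as a complex vector space. -/
def spaceDq (q : ℝ) : Submodule ℂ (ℂ → ℂ) where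
  carrier := {ψ | MemDq q ψ}
  add_mem' := MemDq.add
  zero_mem' := MemDq.zero q
  smul_mem' c _ hψ := MemDq.const_smul hψ c

/-- `∂̄` as an operator on `𝔇_q`. -/
def dbarDq (q : ℝ) : spaceDq q →ₗ[ℂ] spaceDq q where
  toFun ψ := ⟨dbarFun ψ, MemDq.dbarFun ψ.2⟩
  map_add' ψ φ := Subtype.ext
    (dbarFun_add (MemDq.differentiable ψ.2) (MemDq.differentiable φ.2))
  map_smul' c ψ := Subtype.ext (dbarFun_const_smul (MemDq.differentiable ψ.2) c)

/-- The `Λ_{q,l}`-norm, scaled by `C`, as a seminorm on `𝔇_q`. -/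
def seminormDq (q : ℝ) (l : ℕ) (C : ℝ) (hC : 0 ≤ C) : Seminorm ℂ (spaceDq q) :=
  .ofSMulLE (fun ψ => C * lambdaNorm q l ψ)
    (le_antisymm (by
      have h : lambdaNorm q l 0 ≤ 0 := by simpa using MemDq.lambdaNorm_smul_le (.zero q) 0 l
      exact mul_nonpos_of_nonneg_of_nonpos hC h) (mul_nonneg hC (lambdaNorm_nonneg _ _ _)))
    (fun ψ φ => by
      rw [← mul_add]
      exact mul_le_mul_of_nonneg_left (MemDq.lambdaNorm_add_le ψ.2 φ.2 l) hC)
    (fun c ψ => by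
      rw [mul_left_comm]
      exact mul_le_mul_of_nonneg_left (MemDq.lambdaNorm_smul_le ψ.2 c l) hC)

lemma MemDqDual.exists_dbar_solution {a q : ℝ} (ha : 0 < a) (haq : a < q) {T : Dst}
    (hT : MemDqDual q T) (h0 : ∀ k : ℕ, T (fun z => z ^ k) = 0) :
    ∃ g : Dst, MemDqDual a g ∧ ∀ ψ : ℂ → ℂ, MemDq a ψ → -g (dbarFun ψ) = T ψ := by
  classical
  obtain ⟨l, C, hC0, hC⟩ := hT.exists_bound_dbarFun ha haq h0
  let H : Module.Dual ℂ (spaceDq a) :=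
    { toFun := fun ψ => T ψ
      map_add' := fun ψ φ => hT.1 ψ φ (MemDq.mono haq ψ.2) (MemDq.mono haq φ.2)
      map_smul' := fun c ψ => hT.2.1 c ψ (MemDq.mono haq ψ.2) }
  obtain ⟨g, hg, hgp⟩ := exists_dual_comp_eq_of_le_seminorm (dbarDq a) H
    (seminormDq a l C hC0) fun ψ => hC ψ ψ.2
  let G : Dst := fun φ => if hφ : MemDq a φ then -g ⟨φ, hφ⟩ else 0
  have hG : ∀ φ (hφ : MemDq a φ), G φ = -g ⟨φ, hφ⟩ := fun φ hφ => dif_pos hφ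
  refine ⟨G, ⟨fun ψ φ hψ hφ => ?_, fun c ψ hψ => ?_, l, C, fun ψ hψ => ?_⟩, fun ψ hψ => ?_⟩
  · rw [hG _ hψ, hG _ hφ, hG _ (hψ.add hφ), ← neg_add, ← map_add]
    rfl
  · rw [hG _ hψ, hG _ (hψ.const_smul c), mul_neg, ← smul_eq_mul, ← map_smul]
    rfl
  · rw [hG _ hψ, norm_neg]
    exact hgp ⟨ψ, hψ⟩
  · rw [hG _ hψ.dbarFun, neg_neg]
    exact hg ⟨ψ, hψ⟩

/-- **Solvability of the `∂̄`-equation in classes of distributions with Gaussian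
decay.** For `𝐡 ∈ 𝔇'_q`, the existence, for every `q' ∈ (0, q/e)`, of a solution
`𝐠 ∈ 𝔇'_{q'}` of `∂̄𝐠 = 𝐡` (i.e. `-⟨𝐠, ∂̄ψ⟩ = ⟨𝐡, ψ⟩` on test functions in `𝔇_{q'}`)
is equivalent to `⟨𝐡, z^k⟩ = 0` for all `k`. -/
theorem dbar_solvable_iff_orthogonal_to_polynomials
    (q : ℝ) (hq : 0 < q) (h : Dst) (hh : MemDqDual q h) :
    (∀ q' : ℝ, 0 < q' → q' < q / Real.exp 1 →
        ∃ g : Dst, MemDqDual q' g ∧ ∀ ψ : ℂ → ℂ, MemDq q' ψ → -g (dbarFun ψ) = h ψ) ↔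
      (∀ k : ℕ, h (fun z => z ^ k) = 0) := by
  constructor
  · intro H k
    have hq' : 0 < q / (2 * Real.exp 1) := by positivity
    obtain ⟨g, hg, hgh⟩ := H (q / (2 * Real.exp 1)) hq' (by
      have := Real.exp_pos 1
      gcongr
      linarith)
    rw [← hgh _ (MemDq.pow hq' k), dbarFun_eq_zero_of_differentiable (by fun_prop), hg.map_zero,
      neg_zero]
  · intro h0 q' hq'0 hq'
    have hlt : q / Real.exp 1 < q := div_lt_self hq (by simp)
    exact hh.exists_dbar_solution hq'0 (hq'.trans hlt) h0
end
end

section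
/- Let 𝐅 be a distribution in the class Λ'_{q,l} for some q>1 and integer l≥0, and set F = ω^{-1}𝐅. Then the Toeplitz sesquilinear form of F is bounded on the Fock space: for all u,v ∈ 𝓑, |𝐭_F(u,v)| = |⟨𝐅, u v̄⟩| ≤ C(𝐅) ‖u‖_𝓑 ‖v‖_𝓑. -/
open MeasureTheory Filter Complex Metric

noncomputable section

/-- The area mean value property of entire functions on discs of radius one. -/
lemma setIntegral_ball_one_of_differentiable {f : ℂ → ℂ} (hf : Differentiable ℂ f) (c : ℂ) :
    ∫ w in ball c 1, f w = Real.pi * f c := by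
  have hcirc (r : ℝ) : ∫ θ in Set.Ioo (-Real.pi) Real.pi,
      f (c + r * (Real.cos θ + Real.sin θ * Complex.I)) = 2 * Real.pi * f c := by
    have h := (hf.diffContOnCl (s := ball c |r|)).circleAverage
    rw [Real.circleAverage_eq_integral_add (-Real.pi),
      intervalIntegral.integral_comp_add_right (fun θ => f (circleMap c r θ))] at h
    rw [← integral_Ioc_eq_integral_Ioo,
      ← intervalIntegral.integral_of_le (by linarith [Real.pi_pos])]
    have e : (fun θ : ℝ => f (c + r * (Real.cos θ + Real.sin θ * Complex.I))) =
        fun θ : ℝ => f (circleMap c r θ) := by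
      ext θ
      simp [circleMap, Complex.exp_mul_I]
    rw [e, ← h, show 0 + -Real.pi = -Real.pi by ring,
      show 2 * Real.pi + -Real.pi = Real.pi by ring, Complex.real_smul]
    push_cast
    field_simp
  have hcont : Continuous f := hf.continuous
  have hcontp : Continuous fun p : ℝ × ℝ =>
      p.1 • f (c + p.1 * (Real.cos p.2 + Real.sin p.2 * Complex.I)) := by fun_prop
  rw [← integral_indicator measurableSet_ball,
    ← integral_add_left_eq_self ((ball c 1).indicator f) c,
    ← Complex.integral_comp_polarCoord_symm, polarCoord_target]
  calc
    _ = ∫ p in Set.Ioi (0 : ℝ) ×ˢ Set.Ioo (-Real.pi) Real.pi,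
        (Set.Iio (1 : ℝ) ×ˢ Set.univ).indicator (fun p : ℝ × ℝ =>
          p.1 • f (c + p.1 * (Real.cos p.2 + Real.sin p.2 * Complex.I))) p := by
      refine setIntegral_congr_fun (measurableSet_Ioi.prod measurableSet_Ioo) fun p hp => ?_
      have hp1 : 0 < p.1 := hp.1
      have hn : ‖Complex.polarCoord.symm p‖ = p.1 := by
        rw [Complex.norm_polarCoord_symm, abs_of_pos hp1]
      have hmem : c + Complex.polarCoord.symm p ∈ ball c 1 ↔
          p ∈ Set.Iio (1 : ℝ) ×ˢ (Set.univ : Set ℝ) := by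
        simp only [mem_ball, dist_self_add_left, hn, Set.mem_prod, Set.mem_Iio, Set.mem_univ,
          and_true]
      by_cases h : c + Complex.polarCoord.symm p ∈ ball c 1
      · rw [Set.indicator_of_mem h, Set.indicator_of_mem (hmem.1 h),
          Complex.polarCoord_symm_apply]
      · rw [Set.indicator_of_notMem h, Set.indicator_of_notMem (mt hmem.2 h), smul_zero]
    _ = ∫ p in Set.Ioo (0 : ℝ) 1 ×ˢ Set.Ioo (-Real.pi) Real.pi,
          p.1 • f (c + p.1 * (Real.cos p.2 + Real.sin p.2 * Complex.I)) := by
      rw [setIntegral_indicator (measurableSet_Iio.prod MeasurableSet.univ), Set.prod_inter_prod,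
        Set.Ioi_inter_Iio, Set.inter_univ]
    _ = ∫ r in Set.Ioo (0 : ℝ) 1, ∫ θ in Set.Ioo (-Real.pi) Real.pi,
          r • f (c + r * (Real.cos θ + Real.sin θ * Complex.I)) := by
      rw [Measure.volume_eq_prod, setIntegral_prod]
      rw [← Measure.volume_eq_prod]
      exact (hcontp.continuousOn.integrableOn_compact (isCompact_Icc.prod isCompact_Icc)).mono_set
        (Set.prod_mono Set.Ioo_subset_Icc_self Set.Ioo_subset_Icc_self)
    _ = ∫ r in Set.Ioo (0 : ℝ) 1, (r : ℂ) * (2 * Real.pi * f c) := by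
      simp_rw [integral_smul, hcirc, Complex.real_smul]
    _ = Real.pi * f c := by
      rw [integral_mul_const, ← integral_Ioc_eq_integral_Ioo,
        ← intervalIntegral.integral_of_le zero_le_one, intervalIntegral.integral_ofReal,
        integral_id]
      push_cast
      ring

/-- Pointwise growth bound for Fock space functions. -/
lemma norm_le_fockNorm {u : ℂ → ℂ} (hu : MemFock u) (z : ℂ) :
    ‖u z‖ ≤ Real.exp ((‖z‖ + 1) ^ 2 / 2) * fockNorm u := by
  have hnonneg (w : ℂ) : 0 ≤ ‖u w‖ ^ 2 * omegaW w := by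
    unfold omegaW; positivity
  have hI : 0 ≤ ∫ w : ℂ, ‖u w‖ ^ 2 * omegaW w := integral_nonneg hnonneg
  have hmv := setIntegral_ball_one_of_differentiable (hu.1.pow 2) z
  have hsq : Real.pi * ‖u z‖ ^ 2 ≤
      Real.pi * Real.exp ((‖z‖ + 1) ^ 2) * ∫ w : ℂ, ‖u w‖ ^ 2 * omegaW w := by
    calc
      Real.pi * ‖u z‖ ^ 2 = ‖∫ w in ball z 1, (u ^ 2) w‖ := by
        rw [hmv]
        simp [abs_of_pos Real.pi_pos]
      _ ≤ ∫ w in ball z 1, ‖(u ^ 2) w‖ := norm_integral_le_integral_norm _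
      _ ≤ ∫ w in ball z 1,
          Real.pi * Real.exp ((‖z‖ + 1) ^ 2) * (‖u w‖ ^ 2 * omegaW w) := by
        refine setIntegral_mono_on ?_ (hu.2.const_mul _).integrableOn measurableSet_ball ?_
        · have hc : Continuous fun w => ‖(u ^ 2) w‖ := (hu.1.pow 2).continuous.norm
          exact (hc.continuousOn.integrableOn_compact (isCompact_closedBall z 1)).mono_set
            ball_subset_closedBall
        · intro w hw
          have hwz : ‖w‖ ≤ ‖z‖ + 1 := by
            have h1 : ‖w - z‖ < 1 := by simpa [dist_eq_norm] using hw
            have h2 := norm_add_le z (w - z)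
            rw [add_sub_cancel] at h2
            linarith
          have hexp : 1 ≤ Real.exp ((‖z‖ + 1) ^ 2) * Real.exp (-‖w‖ ^ 2) := by
            rw [← Real.exp_add]
            apply Real.one_le_exp
            have := pow_le_pow_left₀ (norm_nonneg w) hwz 2
            linarith
          have e : Real.pi * Real.exp ((‖z‖ + 1) ^ 2) * (‖u w‖ ^ 2 * omegaW w) =
              ‖u w‖ ^ 2 * (Real.exp ((‖z‖ + 1) ^ 2) * Real.exp (-‖w‖ ^ 2)) := by
            unfold omegaW
            field_simp
          rw [e, Pi.pow_apply, norm_pow]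
          exact le_mul_of_one_le_right (by positivity) hexp
      _ = Real.pi * Real.exp ((‖z‖ + 1) ^ 2) * ∫ w in ball z 1, ‖u w‖ ^ 2 * omegaW w :=
        integral_const_mul _ _
      _ ≤ _ := mul_le_mul_of_nonneg_left
        (setIntegral_le_integral hu.2 (Eventually.of_forall hnonneg)) (by positivity)
  rw [mul_assoc] at hsq
  have hsq' := le_of_mul_le_mul_left hsq Real.pi_pos
  rw [Real.exp_half, fockNorm, ← Real.sqrt_mul (Real.exp_pos _).le]
  exact Real.le_sqrt_of_sq_le hsq'

lemma norm_iteratedFDeriv_le_fockNorm {u : ℂ → ℂ} (hu : MemFock u) (n : ℕ) (z : ℂ) :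
    ‖iteratedFDeriv ℝ n u z‖ ≤
      n.factorial * (Real.exp ((‖z‖ + 2) ^ 2 / 2) * fockNorm u) := by
  have hcd : ContDiffAt ℂ n u z := hu.1.contDiff.contDiffAt
  rw [← hcd.restrictScalars_iteratedFDeriv (𝕜 := ℝ), Function.comp_apply,
    ContinuousMultilinearMap.norm_restrictScalars, norm_iteratedFDeriv_eq_norm_iteratedDeriv]
  have h := norm_iteratedDeriv_le_of_forall_mem_sphere_norm_le (c := z) (R := 1)
    (C := Real.exp ((‖z‖ + 2) ^ 2 / 2) * fockNorm u) n one_pos hu.1.diffContOnCl ?_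
  · simpa using h
  · intro w hw
    have hwz : ‖w‖ ≤ ‖z‖ + 1 := by
      have h1 : ‖w - z‖ = 1 := by simpa [dist_eq_norm] using hw
      have h2 := norm_add_le z (w - z)
      rw [add_sub_cancel] at h2
      linarith
    refine (norm_le_fockNorm hu w).trans ?_
    have : 0 ≤ fockNorm u := Real.sqrt_nonneg _
    gcongr ?_ * _
    apply Real.exp_le_exp.2
    have := pow_le_pow_left₀ (by positivity) (show ‖w‖ + 1 ≤ ‖z‖ + 2 by linarith) 2
    linarith

lemma MemFock.contDiff_real {u : ℂ → ℂ} (hu : MemFock u) {n : WithTop ℕ∞} : ContDiff ℝ n u :=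
  (hu.1.contDiff).restrict_scalars ℝ

lemma norm_iteratedFDeriv_mul_conj_le {u v : ℂ → ℂ} (hu : MemFock u) (hv : MemFock v)
    (n : ℕ) (z : ℂ) :
    ‖iteratedFDeriv ℝ n (fun z => u z * (starRingEnd ℂ) (v z)) z‖ ≤
      (n + 1).factorial * Real.exp ((‖z‖ + 2) ^ 2) * (fockNorm u * fockNorm v) := by
  have hcv : ContDiff ℝ n (conjLIE ∘ v) :=
    conjLIE.toContinuousLinearEquiv.contDiff.comp hv.contDiff_real
  have hu0 : 0 ≤ fockNorm u := Real.sqrt_nonneg _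
  have hv0 : 0 ≤ fockNorm v := Real.sqrt_nonneg _
  refine (norm_iteratedFDeriv_mul_le (N := n) hu.contDiff_real hcv z le_rfl).trans ?_
  calc
    _ ≤ ∑ i ∈ Finset.range (n + 1), (n.factorial : ℝ) * Real.exp ((‖z‖ + 2) ^ 2) *
        (fockNorm u * fockNorm v) := by
      refine Finset.sum_le_sum fun i hi => ?_
      have hin : i ≤ n := Nat.lt_succ_iff.1 (Finset.mem_range.1 hi)
      have hv' := norm_iteratedFDeriv_le_fockNorm hv (n - i) z
      rw [← conjLIE.norm_iteratedFDeriv_comp_left] at hv'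
      calc
        _ ≤ (n.choose i : ℝ) * (i.factorial * (Real.exp ((‖z‖ + 2) ^ 2 / 2) * fockNorm u)) *
            ((n - i).factorial * (Real.exp ((‖z‖ + 2) ^ 2 / 2) * fockNorm v)) := by
          gcongr
          exact norm_iteratedFDeriv_le_fockNorm hu i z
        _ = ((n.choose i * i.factorial * (n - i).factorial : ℕ) : ℝ) *
            (Real.exp ((‖z‖ + 2) ^ 2 / 2) * Real.exp ((‖z‖ + 2) ^ 2 / 2)) *
            (fockNorm u * fockNorm v) := by
          push_cast
          ring
        _ = _ := by
          rw [Nat.choose_mul_factorial_mul_factorial hin, ← Real.exp_add, add_halves]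
    _ = _ := by
      rw [Finset.sum_const, Finset.card_range, Nat.factorial_succ]
      push_cast
      ring

/-- For `q > 1`, the weight `exp (-q t²)` beats `exp ((t + 2)²)`. -/
lemma exp_sq_mul_exp_neg_le {q : ℝ} (hq : 1 < q) (t : ℝ) :
    Real.exp ((t + 2) ^ 2) * Real.exp (-q * t ^ 2) ≤
      Real.exp (4 + 25 / (4 * (q - 1))) * Real.exp (-t) := by
  have hq' : 0 < q - 1 := sub_pos.2 hq
  rw [← Real.exp_add, ← Real.exp_add]
  apply Real.exp_le_exp.2
  have h : 0 ≤ (2 * (q - 1) * t - 5) ^ 2 / (4 * (q - 1)) := by positivity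
  have e : (2 * (q - 1) * t - 5) ^ 2 / (4 * (q - 1)) =
      (q - 1) * t ^ 2 - 5 * t + 25 / (4 * (q - 1)) := by
    field_simp
    ring
  linarith

lemma weighted_norm_iteratedFDeriv_mul_conj_le {q : ℝ} (hq : 1 < q) {u v : ℂ → ℂ}
    (hu : MemFock u) (hv : MemFock v) {n l : ℕ} (hn : n ≤ l) (z : ℂ) :
    ‖iteratedFDeriv ℝ n (fun z => u z * (starRingEnd ℂ) (v z)) z‖ * Real.exp (-q * ‖z‖ ^ 2) ≤
      (l + 1).factorial * Real.exp (4 + 25 / (4 * (q - 1))) * (fockNorm u * fockNorm v) *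
        Real.exp (-‖z‖) := by
  have huv : 0 ≤ fockNorm u * fockNorm v := mul_nonneg (Real.sqrt_nonneg _) (Real.sqrt_nonneg _)
  have hfac : ((n + 1).factorial : ℝ) ≤ (l + 1).factorial := by
    exact_mod_cast Nat.factorial_le (by omega)
  calc
    _ ≤ (n + 1).factorial * Real.exp ((‖z‖ + 2) ^ 2) * (fockNorm u * fockNorm v) *
        Real.exp (-q * ‖z‖ ^ 2) := by
      gcongr
      exact norm_iteratedFDeriv_mul_conj_le hu hv n z
    _ = (n + 1).factorial * (fockNorm u * fockNorm v) *
        (Real.exp ((‖z‖ + 2) ^ 2) * Real.exp (-q * ‖z‖ ^ 2)) := by ring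
    _ ≤ (l + 1).factorial * (fockNorm u * fockNorm v) *
        (Real.exp (4 + 25 / (4 * (q - 1))) * Real.exp (-‖z‖)) := by
      gcongr ?_ * _ * ?_
      exact exp_sq_mul_exp_neg_le hq _
    _ = _ := by ring

lemma memLambda_mul_conj {q : ℝ} (hq : 1 < q) (l : ℕ) {u v : ℂ → ℂ}
    (hu : MemFock u) (hv : MemFock v) :
    MemLambda q l fun z => u z * (starRingEnd ℂ) (v z) := by
  refine ⟨hu.contDiff_real.mul
    (conjLIE.toContinuousLinearEquiv.contDiff.comp hv.contDiff_real), fun n hn => ?_⟩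
  refine squeeze_zero (fun z => by positivity)
    (fun z => weighted_norm_iteratedFDeriv_mul_conj_le hq hu hv hn z) ?_
  have h : Tendsto (fun z : ℂ => Real.exp (-‖z‖)) (cocompact ℂ) (nhds 0) :=
    Real.tendsto_exp_neg_atTop_nhds_zero.comp (tendsto_norm_cocompact_atTop)
  simpa using h.const_mul
    ((l + 1).factorial * Real.exp (4 + 25 / (4 * (q - 1))) * (fockNorm u * fockNorm v))

lemma lambdaNorm_mul_conj_le {q : ℝ} (hq : 1 < q) (l : ℕ) {u v : ℂ → ℂ}
    (hu : MemFock u) (hv : MemFock v) :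
    lambdaNorm q l (fun z => u z * (starRingEnd ℂ) (v z)) ≤
      (l + 1).factorial * Real.exp (4 + 25 / (4 * (q - 1))) * (fockNorm u * fockNorm v) := by
  have hK : 0 ≤ (l + 1).factorial * Real.exp (4 + 25 / (4 * (q - 1))) *
      (fockNorm u * fockNorm v) := by
    have := mul_nonneg (Real.sqrt_nonneg _ : 0 ≤ fockNorm u) (Real.sqrt_nonneg _ : 0 ≤ fockNorm v)
    positivity
  refine Real.sSup_le ?_ hK
  rintro r ⟨n, hn, z, rfl⟩
  refine (weighted_norm_iteratedFDeriv_mul_conj_le hq hu hv hn z).trans ?_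
  exact mul_le_of_le_one_right hK (Real.exp_le_one_iff.2 (by simp))

/-- **Boundedness of the Toeplitz form.** If `𝐅 ∈ Λ'_{q,l}` with `q > 1`, then the
Toeplitz sesquilinear form `𝐭_F(u,v) = ⟨𝐅, u v̄⟩` (with `F = ω⁻¹𝐅`) is bounded on
the Fock space. -/
theorem toeplitz_form_bounded
    (q : ℝ) (hq : 1 < q) (l : ℕ) (T : Dst) (hT : MemLambdaDual q l T) :
    ∃ C : ℝ, ∀ u v : ℂ → ℂ, MemFock u → MemFock v →
      ‖toeplitzForm T u v‖ ≤ C * fockNorm u * fockNorm v := by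
  obtain ⟨-, -, C, hC⟩ := hT
  refine ⟨|C| * ((l + 1).factorial * Real.exp (4 + 25 / (4 * (q - 1)))), fun u v hu hv => ?_⟩
  have hnonneg : 0 ≤ lambdaNorm q l (fun z => u z * (starRingEnd ℂ) (v z)) :=
    Real.sSup_nonneg (by rintro r ⟨n, -, z, rfl⟩; positivity)
  calc
    ‖toeplitzForm T u v‖ ≤ C * lambdaNorm q l (fun z => u z * (starRingEnd ℂ) (v z)) :=
      hC _ (memLambda_mul_conj hq l hu hv)
    _ ≤ |C| * lambdaNorm q l (fun z => u z * (starRingEnd ℂ) (v z)) := by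
      gcongr
      exact le_abs_self C
    _ ≤ |C| * ((l + 1).factorial * Real.exp (4 + 25 / (4 * (q - 1))) *
        (fockNorm u * fockNorm v)) := by
      gcongr
      exact lambdaNorm_mul_conj_le hq l hu hv
    _ = _ := by ring
end
end

section
/- Let F be a distribution on ℂ with compact support such that the Toeplitz sesquilinear form 𝐭_F(u,v) = ⟨F, ω u v̄⟩ is bounded on the Fock space: |⟨F, ω u v̄⟩| ≤ C‖u‖_𝓑‖v‖_𝓑 for all u,v ∈ 𝓑. Suppose that the infinite matrices 𝔓(F) and 𝔎(F) (the latter for every sequence of points) have rank at most N. Then the bounded Toeplitz operator T(F) on 𝓑 defined by this form has rank at most N, i.e., there exist f_1,…,f_N, g_1,…,g_N ∈ 𝓑 such that (T(F)u, v) = Σ_{j=1}^N (u, g_j)(f_j, v) for all u,v ∈ 𝓑. -/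
open MeasureTheory Filter Complex Metric

noncomputable section

/-- Membership in `𝓔'(ℂ)`: a linear functional on smooth functions which has
compact support and is continuous (bounded by a `C^n`-seminorm on a compact set). -/
def MemEprime (T : Dst) : Prop :=
  (∀ ψ φ, ContDiff ℝ (⊤ : ℕ∞) ψ → ContDiff ℝ (⊤ : ℕ∞) φ → T (ψ + φ) = T ψ + T φ) ∧
  (∀ (c : ℂ) (ψ), ContDiff ℝ (⊤ : ℕ∞) ψ → T (c • ψ) = c * T ψ) ∧
  ∃ (K : Set ℂ) (n : ℕ) (C : ℝ), IsCompact K ∧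
    (∀ ψ, ContDiff ℝ (⊤ : ℕ∞) ψ → Disjoint (tsupport ψ) K → T ψ = 0) ∧
    ∀ ψ, ContDiff ℝ (⊤ : ℕ∞) ψ →
      ‖T ψ‖ ≤ C * sSup {r : ℝ | ∃ m ≤ n, ∃ z ∈ K, r = ‖iteratedFDeriv ℝ m ψ z‖}

section FiniteRank

variable {E : Type*} [NormedAddCommGroup E] [InnerProductSpace ℂ E]

lemma card_le_of_linearIndependent_of_infRankLE (A : E → E) (κ : ℕ → E)
    (hκ : (Submodule.span ℂ (Set.range κ))ᗮ = ⊥) {N n : ℕ}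
    (hA : InfRankLE (fun i j => inner ℂ (A (κ j)) (κ i)) N) (c : Fin n → ℕ)
    (hc : LinearIndependent ℂ fun l => A (κ (c l))) : n ≤ N := by
  set ρ : ℕ → Fin n → ℂ := fun i l => inner ℂ (A (κ (c l))) (κ i) with hρ
  have hspan : Submodule.span ℂ (Set.range ρ) = ⊤ := by
    by_contra hne
    obtain ⟨φ, hφ0, hφ⟩ :=
      Submodule.exists_le_ker_of_lt_top _ (lt_top_iff_ne_top.2 hne)
    have hφs : ∀ x, φ x = ∑ l, x l * φ (Pi.single l 1) := fun x => by
      conv_lhs => rw [pi_eq_sum_univ' x, map_sum]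
      simp
    have hy : (∑ l, starRingEnd ℂ (φ (Pi.single l 1)) • A (κ (c l))) = 0 := by
      rw [← Submodule.mem_bot ℂ, ← hκ, Submodule.mem_orthogonal']
      intro u hu
      induction hu using Submodule.span_induction with
      | mem x hx =>
        obtain ⟨i, rfl⟩ := hx
        have h0 : φ (ρ i) = 0 := hφ (Submodule.subset_span ⟨i, rfl⟩)
        rw [hφs] at h0
        simpa [sum_inner, inner_smul_left, hρ, mul_comm] using h0
      | zero => simp
      | add x y _ _ hx hy => rw [inner_add_right, hx, hy, add_zero]
      | smul a x _ hx => rw [inner_smul_right, hx, mul_zero]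
    have h0 := Fintype.linearIndependent_iff.1 hc _ hy
    refine hφ0 (LinearMap.ext fun x => ?_)
    rw [hφs]
    exact Finset.sum_eq_zero fun l _ => by rw [(map_eq_zero _).1 (h0 l), mul_zero]
  obtain ⟨ι, a, -, haspan, hali⟩ := exists_linearIndependent' ℂ ρ
  let b := Module.Basis.mk hali (by rw [haspan, hspan])
  let e := b.indexEquiv (Pi.basisFun ℂ (Fin n))
  have hli : LinearIndependent ℂ
      (Matrix.of fun i j : Fin n => inner ℂ (A (κ (c j))) (κ (a (e.symm i)))).row :=
    hali.comp e.symm e.symm.injective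
  have := hA n (fun i => a (e.symm i)) c
  rwa [hli.rank_matrix, Fintype.card_fin] at this

lemma exists_inner_eq_sum_of_infRankLE [CompleteSpace E] (A : E →L[ℂ] E) (κ : ℕ → E)
    (hκ : (Submodule.span ℂ (Set.range κ))ᗮ = ⊥) {N : ℕ}
    (hA : InfRankLE (fun i j => inner ℂ (A (κ j)) (κ i)) N) :
    ∃ f g : Fin N → E, ∀ v w : E,
      inner ℂ (A v) w = ∑ j, inner ℂ (f j) w * inner ℂ v (g j) := by
  obtain ⟨ι, a, -, haspan, hali⟩ := exists_linearIndependent' ℂ fun j => A (κ j)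
  set W := Submodule.span ℂ (Set.range fun j => A (κ j))
  have hι : Cardinal.mk ι ≤ N := by
    by_contra! hlt
    have hle : Cardinal.mk (Fin (N + 1)) ≤ Cardinal.lift.{0} (Cardinal.mk ι) := by
      simpa using Order.succ_le_of_lt hlt
    obtain ⟨t⟩ := Cardinal.lift_mk_le'.1 (by simpa using hle :
      Cardinal.lift (Cardinal.mk (Fin (N + 1))) ≤ Cardinal.lift (Cardinal.mk ι))
    have := card_le_of_linearIndependent_of_infRankLE A κ hκ hA (a ∘ t)
      (hali.comp t t.injective)
    omega
  have hfin : Finite ι := Cardinal.mk_lt_aleph0_iff.1 (hι.trans_lt (Cardinal.natCast_lt_aleph0))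
  have := Fintype.ofFinite ι
  have hfd : FiniteDimensional ℂ W :=
    haspan ▸ FiniteDimensional.span_of_finite ℂ (Set.finite_range _)
  have hrank : Module.finrank ℂ W ≤ N := by
    rw [← haspan, finrank_span_eq_card hali]
    simpa using hι
  have hmem : ∀ v, A v ∈ W := by
    have hle : (Submodule.span ℂ (Set.range κ)).topologicalClosure ≤ W.comap A.toLinearMap := by
      refine Submodule.topologicalClosure_minimal _ ?_
        ((Submodule.closed_of_finiteDimensional W).preimage A.continuous)
      rw [Submodule.span_le]
      rintro _ ⟨j, rfl⟩
      exact Submodule.subset_span ⟨j, rfl⟩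
    rw [Submodule.topologicalClosure_eq_top_iff.2 hκ] at hle
    exact fun v => hle Submodule.mem_top
  let b := stdOrthonormalBasis ℂ W
  obtain ⟨e, rfl⟩ := Nat.exists_eq_add_of_le hrank
  refine ⟨Fin.append (fun i => (b i : E)) 0, Fin.append (fun i => A.adjoint (b i)) 0,
    fun v w => ?_⟩
  have hAv : A v = ∑ i, (inner ℂ (b i : E) (A v)) • (b i : E) := by
    have := congrArg (Subtype.val) (b.sum_repr' ⟨A v, hmem v⟩)
    simpa using this.symm
  rw [Fin.sum_univ_add, hAv, sum_inner]
  simp [inner_smul_left, ContinuousLinearMap.adjoint_inner_right, mul_comm]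

end FiniteRank

section Fock

lemma omegaW_pos (z : ℂ) : 0 < omegaW z := by unfold omegaW; positivity

lemma contDiff_omegaW {n : WithTop ℕ∞} : ContDiff ℝ n omegaW :=
  contDiff_const.mul (contDiff_norm_sq ℝ).neg.exp

lemma continuous_omegaW : Continuous omegaW := contDiff_omegaW (n := 0).continuous

lemma integrable_omegaW : Integrable omegaW := by
  have h := (GaussianFourier.integrable_cexp_neg_mul_sq_norm_add (V := ℂ) (b := 1)
    (by simp) 0 0).norm
  refine (h.const_mul Real.pi⁻¹).congr (.of_forall fun z => ?_)
  simp [omegaW, Complex.norm_exp, ← Complex.ofReal_pow]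

lemma integral_omegaW : ∫ z, omegaW z = 1 := by
  have h := GaussianFourier.integral_rexp_neg_mul_sq_norm (V := ℂ) (b := 1) one_pos
  simp only [Complex.finrank_real_complex] at h
  simp only [omegaW, integral_const_mul]
  norm_num at h
  rw [h, inv_mul_cancel₀ Real.pi_ne_zero]

/-- The function `u √ω`, whose square integrability means that `u` lies in the weighted space. -/
def weighted (u : ℂ → ℂ) : ℂ → ℂ := fun z => (Real.sqrt (omegaW z) : ℂ) * u z

lemma continuous_weighted {u : ℂ → ℂ} (hu : Continuous u) : Continuous (weighted u) :=
  (Complex.continuous_ofReal.comp continuous_omegaW.sqrt).mul hu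

lemma norm_weighted_sq (u : ℂ → ℂ) (z : ℂ) : ‖weighted u z‖ ^ 2 = ‖u z‖ ^ 2 * omegaW z := by
  rw [weighted, norm_mul, mul_pow, Complex.norm_real, Real.norm_eq_abs, sq_abs,
    Real.sq_sqrt (omegaW_pos z).le, mul_comm]

lemma weighted_mul_conj_weighted (u v : ℂ → ℂ) (z : ℂ) :
    weighted u z * starRingEnd ℂ (weighted v z) =
      u z * starRingEnd ℂ (v z) * (omegaW z : ℂ) := by
  have h : (Real.sqrt (omegaW z) : ℂ) * Real.sqrt (omegaW z) = omegaW z := by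
    rw [← Complex.ofReal_mul, Real.mul_self_sqrt (omegaW_pos z).le]
  rw [← h, weighted, weighted, map_mul, Complex.conj_ofReal]
  ring

lemma weighted_injective : Function.Injective weighted := fun u v h => funext fun z => by
  have hz : (Real.sqrt (omegaW z) : ℂ) ≠ 0 :=
    Complex.ofReal_ne_zero.2 (Real.sqrt_pos.2 (omegaW_pos z)).ne'
  exact mul_left_cancel₀ hz (congrFun h z)

lemma memFock_iff {u : ℂ → ℂ} : MemFock u ↔ Differentiable ℂ u ∧ MemLp (weighted u) 2 := by
  refine and_congr_right fun hu => ?_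
  rw [memLp_two_iff_integrable_sq_norm (continuous_weighted hu.continuous).aestronglyMeasurable]
  simp only [norm_weighted_sq]

/-- The Fock space as a space of entire functions. -/
def fockSpace : Submodule ℂ (ℂ → ℂ) where
  carrier := {u | MemFock u}
  zero_mem' := memFock_iff.2 ⟨differentiable_const _,
    (MemLp.zero' (ε := ℂ)).ae_eq (.of_forall fun z => by simp [weighted])⟩
  add_mem' {u v} hu hv := by
    rw [Set.mem_ofPred_eq, memFock_iff] at *
    refine ⟨hu.1.add hv.1, (hu.2.add hv.2).ae_eq (.of_forall fun z => ?_)⟩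
    simp [weighted, mul_add]
  smul_mem' c u hu := by
    rw [Set.mem_ofPred_eq, memFock_iff] at *
    refine ⟨hu.1.const_smul c, (hu.2.const_smul c).ae_eq (.of_forall fun z => ?_)⟩
    simp [weighted, mul_left_comm]

lemma memLp_weighted (u : fockSpace) : MemLp (weighted u) 2 := (memFock_iff.1 u.2).2

/-- The embedding of the Fock space in the unweighted space `L²(ℂ)`. -/
def fockToLp : fockSpace →ₗ[ℂ] Lp ℂ 2 (volume : Measure ℂ) where
  toFun u := (memLp_weighted u).toLp
  map_add' u v := by
    rw [← MemLp.toLp_add, MemLp.toLp_eq_toLp_iff]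
    exact .of_forall fun z => by simp [weighted, mul_add]
  map_smul' c u := by
    rw [RingHom.id_apply, ← MemLp.toLp_const_smul, MemLp.toLp_eq_toLp_iff]
    exact .of_forall fun z => by simp [weighted, mul_left_comm]

lemma coeFn_fockToLp (u : fockSpace) : fockToLp u =ᵐ[volume] weighted u :=
  (memLp_weighted u).coeFn_toLp

lemma fockToLp_injective : Function.Injective fockToLp := fun u v h => by
  have h' : weighted u =ᵐ[volume] weighted v := (MemLp.toLp_eq_toLp_iff (memLp_weighted u) (memLp_weighted v)).1 h
  rw [Continuous.ae_eq_iff_eq _ (continuous_weighted u.2.1.continuous)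
    (continuous_weighted v.2.1.continuous)] at h'
  exact Subtype.ext (weighted_injective h')

lemma inner_fockToLp (u v : fockSpace) :
    inner ℂ (fockToLp v) (fockToLp u) = fockInner u v := by
  rw [L2.inner_def, fockInner]
  refine integral_congr_ae ?_
  filter_upwards [coeFn_fockToLp u, coeFn_fockToLp v] with z hu hv
  rw [hu, hv, RCLike.inner_apply, weighted_mul_conj_weighted]

lemma norm_fockToLp (u : fockSpace) : ‖fockToLp u‖ = fockNorm u := by
  have h : ((‖fockToLp u‖ ^ 2 : ℝ) : ℂ) = ((∫ z, ‖(u : ℂ → ℂ) z‖ ^ 2 * omegaW z : ℝ) : ℂ) := by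
    rw [Complex.ofReal_pow]
    refine (inner_self_eq_norm_sq_to_K (𝕜 := ℂ) (fockToLp u)).symm.trans ?_
    rw [inner_fockToLp, fockInner, ← integral_complex_ofReal]
    refine integral_congr_ae (.of_forall fun z => ?_)
    simp [Complex.mul_conj']
  rw [fockNorm, ← Complex.ofReal_injective h, Real.sqrt_sq (norm_nonneg _)]

/-- The mean value property of entire functions for the Gaussian measure. -/
lemma integral_mul_omegaW {f : ℂ → ℂ} (hf : Differentiable ℂ f)
    (hi : Integrable fun w => f w * (omegaW w : ℂ)) : ∫ w, f w * (omegaW w : ℂ) = f 0 := by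
  set F : ℝ → ℂ → ℂ := fun θ w => f (Circle.exp θ * w) * (omegaW w : ℂ) with hF
  have hFrot : ∀ θ, F θ = (fun w => f w * (omegaW w : ℂ)) ∘ rotation (Circle.exp θ) := fun θ => by
    ext w
    simp [hF, omegaW]
  have hFi : ∀ θ, Integrable (F θ) := fun θ => by
    rw [hFrot]
    exact ((rotation _).measurePreserving.integrable_comp_emb
      (rotation _).toHomeomorph.measurableEmbedding).2 hi
  have hFint : ∀ θ, ∫ w, F θ w = ∫ w, f w * (omegaW w : ℂ) := fun θ => by
    rw [hFrot]
    exact (rotation _).measurePreserving.integral_comp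
      (rotation _).toHomeomorph.measurableEmbedding fun w => f w * (omegaW w : ℂ)
  have hFnorm : ∀ θ, ∫ w, ‖F θ w‖ = ∫ w, ‖f w * (omegaW w : ℂ)‖ := fun θ => by
    rw [hFrot]
    exact (rotation _).measurePreserving.integral_comp
      (rotation _).toHomeomorph.measurableEmbedding fun w => ‖f w * (omegaW w : ℂ)‖
  have hFc : Continuous (Function.uncurry F) := by
    have := hf.continuous
    have := continuous_omegaW
    simp only [hF, Function.uncurry_def]
    fun_prop
  have hswap : ∫ θ in (0)..(2 * Real.pi), ∫ w, F θ w = ∫ w, ∫ θ in (0)..(2 * Real.pi), F θ w := by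
    simp only [intervalIntegral.integral_of_le Real.two_pi_pos.le]
    refine integral_integral_swap ?_
    refine (integrable_prod_iff hFc.aestronglyMeasurable).2 ⟨.of_forall hFi, ?_⟩
    simp only [Function.uncurry_apply_pair, hFnorm]
    exact integrable_const _
  have hcirc : ∀ w, ∫ θ in (0)..(2 * Real.pi), F θ w = 2 * Real.pi * (f 0 * (omegaW w : ℂ)) := by
    intro w
    have hg : Differentiable ℂ fun ζ => f (ζ * w) := hf.comp (differentiable_id.mul_const w)
    have h := (hg.diffContOnCl (s := ball 0 |1|)).circleAverage
    rw [Real.circleAverage_def, inv_smul_eq_iff₀ Real.two_pi_pos.ne'] at h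
    simp only [hF, intervalIntegral.integral_mul_const]
    simp only [circleMap, zero_add, Complex.ofReal_one, one_mul, zero_mul, Complex.real_smul] at h
    simp only [Circle.coe_exp, h]
    push_cast
    ring
  simp only [hFint, hcirc] at hswap
  rw [integral_const_mul, integral_const_mul, integral_complex_ofReal, integral_omegaW] at hswap
  rw [intervalIntegral.integral_const, Complex.real_smul] at hswap
  push_cast at hswap
  have h2 : (2 * Real.pi : ℂ) ≠ 0 := by exact_mod_cast Real.two_pi_pos.ne'
  rw [sub_zero, mul_one] at hswap
  exact mul_left_cancel₀ h2 hswap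

lemma norm_repKer_sq_mul_omegaW (z w : ℂ) :
    ‖repKer z w‖ ^ 2 * omegaW w = Real.exp (‖z‖ ^ 2) * omegaW (w - z) := by
  rw [repKer, Complex.norm_exp, omegaW, omegaW, ← Real.exp_nat_mul, mul_left_comm,
    mul_left_comm (Real.exp (‖z‖ ^ 2)), ← Real.exp_add, ← Real.exp_add]
  congr 2
  simp only [← Complex.normSq_eq_norm_sq, Complex.normSq_apply, Complex.mul_re, Complex.conj_re,
    Complex.conj_im, Complex.sub_re, Complex.sub_im]
  push_cast
  ring

lemma memFock_repKer (z : ℂ) : MemFock (repKer z) := by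
  refine ⟨(differentiable_id.mul_const _).cexp, ?_⟩
  simp only [norm_repKer_sq_mul_omegaW]
  exact (integrable_omegaW.comp_sub_right z).const_mul _

/-- The reproducing kernel as an element of the Fock space. -/
def kernelElem (z : ℂ) : fockSpace := ⟨repKer z, memFock_repKer z⟩

lemma fockNorm_repKer (z : ℂ) : fockNorm (repKer z) = Real.sqrt (Real.exp (‖z‖ ^ 2)) := by
  simp only [fockNorm, norm_repKer_sq_mul_omegaW, integral_const_mul]
  rw [integral_sub_right_eq_self omegaW z, integral_omegaW, mul_one]

/-- The reproducing property. -/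
lemma fockInner_repKer {u : ℂ → ℂ} (hu : MemFock u) (z : ℂ) : fockInner u (repKer z) = u z := by
  set f : ℂ → ℂ := fun w => u (w + z) * cexp (-(w * starRingEnd ℂ z)) with hf
  have key : ∀ w, f (w - z) * (omegaW (w - z) : ℂ) =
      u w * starRingEnd ℂ (repKer z w) * (omegaW w : ℂ) := fun w => by
    simp only [hf, sub_add_cancel, repKer, omegaW, ← Complex.exp_conj, Complex.ofReal_mul,
      Complex.ofReal_exp, mul_assoc]
    rw [mul_left_comm (cexp _), mul_left_comm (cexp _), ← Complex.exp_add, ← Complex.exp_add]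
    congr 3
    push_cast
    simp only [← Complex.mul_conj', map_sub, map_mul, Complex.conj_conj]
    ring
  have hi : Integrable fun w => u w * starRingEnd ℂ (repKer z w) * (omegaW w : ℂ) := by
    have h := L2.integrable_inner (𝕜 := ℂ) (fockToLp (kernelElem z)) (fockToLp ⟨u, hu⟩)
    refine h.congr ?_
    filter_upwards [coeFn_fockToLp ⟨u, hu⟩, coeFn_fockToLp (kernelElem z)] with w h1 h2
    rw [h1, h2, RCLike.inner_apply, weighted_mul_conj_weighted]
    rfl
  have hd : Differentiable ℂ f := by
    have := hu.1
    fun_prop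
  have hfi : Integrable fun w => f w * (omegaW w : ℂ) := by
    have := hi.comp_add_right z
    simpa only [← key, add_sub_cancel_right] using this
  have h := integral_mul_omegaW hd hfi
  rw [← integral_sub_right_eq_self _ z] at h
  simp only [key] at h
  simpa [hf, fockInner] using h

lemma inner_kernelElem (u : fockSpace) (z : ℂ) :
    inner ℂ (fockToLp (kernelElem z)) (fockToLp u) = (u : ℂ → ℂ) z := by
  rw [inner_fockToLp]
  exact fockInner_repKer u.2 z

lemma norm_fockToLp_kernelElem (z : ℂ) :
    ‖fockToLp (kernelElem z)‖ = Real.sqrt (Real.exp (‖z‖ ^ 2)) :=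
  (norm_fockToLp _).trans (fockNorm_repKer z)

lemma isClosed_range_fockToLp : IsClosed (Set.range fockToLp) := by
  refine isClosed_of_closure_subset fun g hg => ?_
  obtain ⟨x, hx, hxg⟩ := mem_closure_iff_seq_limit.1 hg
  choose u hu using hx
  obtain rfl : (fun n => fockToLp (u n)) = x := funext hu
  set v : ℂ → ℂ := fun z => inner ℂ (fockToLp (kernelElem z)) g with hv
  have hbound : ∀ n z, ‖v z - (u n : ℂ → ℂ) z‖ ≤
      Real.sqrt (Real.exp (‖z‖ ^ 2)) * ‖g - fockToLp (u n)‖ := fun n z => by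
    rw [← inner_kernelElem, hv, ← inner_sub_right, ← norm_fockToLp_kernelElem]
    exact norm_inner_le_norm _ _
  have hnorm : Tendsto (fun n => ‖g - fockToLp (u n)‖) atTop (nhds 0) := by
    simpa using ((tendsto_const_nhds (x := g)).sub hxg).norm
  have hpt : ∀ z, Tendsto (fun n => (u n : ℂ → ℂ) z) atTop (nhds (v z)) := fun z => by
    simp only [← inner_kernelElem]
    exact tendsto_const_nhds.inner hxg
  have hunif : TendstoLocallyUniformlyOn (fun n => (u n : ℂ → ℂ)) v atTop Set.univ := by
    rw [tendstoLocallyUniformlyOn_iff_forall_isCompact isOpen_univ]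
    intro K _ hK
    obtain ⟨M, hM⟩ := hK.exists_bound_of_continuousOn
      (f := fun z : ℂ => Real.sqrt (Real.exp (‖z‖ ^ 2))) (by fun_prop)
    rw [Metric.tendstoUniformlyOn_iff]
    intro ε hε
    have h0 : Tendsto (fun n => M * ‖g - fockToLp (u n)‖) atTop (nhds 0) := by
      simpa using hnorm.const_mul M
    filter_upwards [h0.eventually_lt_const hε] with n hn z hz
    rw [dist_eq_norm]
    refine (hbound n z).trans_lt (lt_of_le_of_lt ?_ hn)
    exact mul_le_mul_of_nonneg_right ((Real.le_norm_self _).trans (hM z hz)) (norm_nonneg _)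
  have hd : Differentiable ℂ v := differentiableOn_univ.1 <|
    hunif.differentiableOn (.of_forall fun n => (u n).2.1.differentiableOn) isOpen_univ
  obtain ⟨ns, hns, hae⟩ := (tendstoInMeasure_of_tendsto_Lp hxg).exists_seq_tendsto_ae
  have hgv : g =ᵐ[volume] weighted v := by
    filter_upwards [hae, ae_all_iff.2 fun n => coeFn_fockToLp (u n)] with z hz hw
    simp only [hw] at hz
    exact tendsto_nhds_unique hz (((hpt z).comp hns.tendsto_atTop).const_mul _)
  have hmem : MemFock v := memFock_iff.2 ⟨hd, (Lp.memLp g).ae_eq hgv⟩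
  refine ⟨⟨v, hmem⟩, Lp.ext ?_⟩
  exact (coeFn_fockToLp _).trans hgv.symm

lemma contDiff_toeplitz {u v : ℂ → ℂ} (hu : Differentiable ℂ u) (hv : Differentiable ℂ v)
    {n : WithTop ℕ∞} :
    ContDiff ℝ n fun z => (omegaW z : ℂ) * (u z * starRingEnd ℂ (v z)) :=
  (Complex.ofRealCLM.contDiff.comp contDiff_omegaW).mul
    ((hu.contDiff.restrict_scalars ℝ).mul
      (Complex.conjCLE.contDiff.comp (hv.contDiff.restrict_scalars ℝ)))

/-- The Toeplitz form of a compactly supported distribution as a sesquilinear form on the Fock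
space, conjugate linear in its first argument. -/
def toeplitzSesq (T : Dst) (hT : MemEprime T) : fockSpace →ₗ⋆[ℂ] fockSpace →ₗ[ℂ] ℂ :=
  LinearMap.mk₂'ₛₗ (starRingEnd ℂ) (RingHom.id ℂ)
    (fun v u => T fun z => (omegaW z : ℂ) * ((u : ℂ → ℂ) z * starRingEnd ℂ ((v : ℂ → ℂ) z)))
    (fun v w u => by
      rw [← hT.1 _ _ (contDiff_toeplitz u.2.1 v.2.1) (contDiff_toeplitz u.2.1 w.2.1)]
      congr 1
      ext z
      simp [mul_add])
    (fun c v u => by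
      rw [smul_eq_mul, ← hT.2.1 _ _ (contDiff_toeplitz u.2.1 v.2.1)]
      congr 1
      ext z
      simp [mul_left_comm])
    (fun v u w => by
      rw [← hT.1 _ _ (contDiff_toeplitz u.2.1 v.2.1) (contDiff_toeplitz w.2.1 v.2.1)]
      congr 1
      ext z
      simp [mul_add, add_mul])
    (fun c v u => by
      rw [RingHom.id_apply, smul_eq_mul, ← hT.2.1 _ _ (contDiff_toeplitz u.2.1 v.2.1)]
      congr 1
      ext z
      simp [mul_left_comm, mul_assoc])

end Fock

/-- **Finite rank matrices give a finite rank operator (bounded, compactly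
supported case).** Here `T` is the pairing of the compactly supported
distribution `F` itself (w.r.t. Lebesgue measure), so that
`𝐭_F(u,v) = ⟨F, ω u v̄⟩ = T (ω u v̄)`. -/
theorem finite_rank_matrices_imply_finite_rank_operator
    (N : ℕ) (T : Dst) (hT : MemEprime T)
    (hb : ∃ C : ℝ, ∀ u v : ℂ → ℂ, MemFock u → MemFock v →
      ‖T (fun z => (omegaW z : ℂ) * (u z * (starRingEnd ℂ) (v z)))‖ ≤
        C * fockNorm u * fockNorm v)
    (hP : InfRankLE
      (fun k k' => T (fun z => (omegaW z : ℂ) * (z ^ k * (starRingEnd ℂ) z ^ k'))) N)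
    (hK : ∀ zs : ℕ → ℂ, InfRankLE
      (fun k k' => T (fun w => (omegaW w : ℂ) *
        (repKer (zs k) w * (starRingEnd ℂ) (repKer (zs k') w)))) N) :
    ∃ f g : Fin N → ℂ → ℂ, (∀ j, MemFock (f j)) ∧ (∀ j, MemFock (g j)) ∧
      ∀ u v : ℂ → ℂ, MemFock u → MemFock v →
        T (fun z => (omegaW z : ℂ) * (u z * (starRingEnd ℂ) (v z))) =
          ∑ j : Fin N, fockInner u (g j) * fockInner (f j) v := by
  obtain ⟨C, hC⟩ := hb
  have : CompleteSpace (LinearMap.range fockToLp) :=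
    (LinearMap.coe_range fockToLp ▸ isClosed_range_fockToLp).completeSpace_coe
  let e := LinearEquiv.ofInjective fockToLp fockToLp_injective
  have he : ∀ x, fockToLp (e.symm x) = x := fun x =>
    congrArg Subtype.val (e.apply_symm_apply x)
  let B : LinearMap.range fockToLp →L⋆[ℂ] LinearMap.range fockToLp →L[ℂ] ℂ :=
    LinearMap.mkContinuous₂ 
      (((toeplitzSesq T hT).comp e.symm.toLinearMap).compl₂ e.symm.toLinearMap) C
      fun x y => by
        have h := hC _ _ (e.symm y).2 (e.symm x).2
        rw [← norm_fockToLp, ← norm_fockToLp, he, he] at h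
        exact h.trans_eq (mul_right_comm _ _ _)
  have hB : ∀ u v : fockSpace, B (e v) (e u) =
      T fun z => (omegaW z : ℂ) * ((u : ℂ → ℂ) z * starRingEnd ℂ ((v : ℂ → ℂ) z)) :=
    fun u v => by simp [B, toeplitzSesq]
  have hinner : ∀ u v : fockSpace, inner ℂ (e v) (e u) = fockInner u v := inner_fockToLp
  let A := InnerProductSpace.continuousLinearMapOfBilin B
  have hA : ∀ x y, inner ℂ (A x) y = B x y :=
    InnerProductSpace.continuousLinearMapOfBilin_apply B
  let κ : ℕ → LinearMap.range fockToLp := fun n => e (kernelElem (TopologicalSpace.denseSeq ℂ n))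
  have hκ : (Submodule.span ℂ (Set.range κ))ᗮ = ⊥ := by
    refine (Submodule.eq_bot_iff _).2 fun x hx => ?_
    obtain ⟨u, rfl⟩ := e.surjective x
    have h0 : (u : ℂ → ℂ) = 0 := by
      refine u.2.1.continuous.ext_on (TopologicalSpace.denseRange_denseSeq ℂ) continuous_const ?_
      rintro _ ⟨n, rfl⟩
      rw [← inner_kernelElem]
      exact (Submodule.mem_orthogonal _ _).1 hx _ (Submodule.subset_span ⟨n, rfl⟩)
    rw [show u = 0 from Subtype.ext h0, map_zero]
  have hrank : InfRankLE (fun i j => inner ℂ (A (κ j)) (κ i)) N := by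
    simp only [hA, κ, hB]
    exact hK (TopologicalSpace.denseSeq ℂ)
  obtain ⟨f, g, hfg⟩ := exists_inner_eq_sum_of_infRankLE A κ hκ hrank
  refine ⟨fun j => e.symm (g j), fun j => e.symm (f j), fun j => (e.symm (g j)).2,
    fun j => (e.symm (f j)).2, fun u v hu hv => ?_⟩
  have h := hfg (e ⟨v, hv⟩) (e ⟨u, hu⟩)
  rw [hA, hB] at h
  rw [h]
  refine Finset.sum_congr rfl fun j _ => ?_
  rw [← hinner ⟨u, hu⟩, ← hinner _ ⟨v, hv⟩, e.apply_symm_apply, e.apply_symm_apply]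
end
end
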